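/- arXiv:1911.07287 — 4 statements merged into one kernel-verified Lean document; each statement's English description precedes it below -/
import Mathlib

section
/- Let m ≥ 0 be an integer and let α and β be two distinct Jordan arcs in the plane whose intersection α ∩ β is a finite set of at most m points. Then the complement ℝ² \ (α ∪ β) has at most m + 2 connected components. -/
noncomputable section

abbrev Plane : Type := EuclideanSpace ℝ (Fin 2)

/-- A closed Jordan curve: a subset of the plane homeomorphic to the unit circle. -/
def IsJordanCurve (γ : Set Plane) : Prop :=
  Nonempty (γ ≃ₜ Metric.sphere (0 : Plane) 1)

/-- A Jordan arc: a subset of the plane homeomorphic to the closed unit interval. -/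
def IsJordanArc (γ : Set Plane) : Prop :=
  Nonempty (γ ≃ₜ unitInterval)

/-- General position: any two distinct members intersect in a finite set, and no point
of the plane lies on three distinct members. -/
def GenPos {n : ℕ} (γ : Fin n → Set Plane) : Prop :=
  (∀ i j : Fin n, i ≠ j → (γ i ∩ γ j).Finite) ∧
  (∀ p : Plane, ∀ i j k : Fin n, p ∈ γ i → p ∈ γ j → p ∈ γ k → i = j ∨ i = k ∨ j = k)

/-- `m`-intersecting: any two distinct members intersect in at most `m` points. -/
def MIntersecting {n : ℕ} (m : ℕ) (γ : Fin n → Set Plane) : Prop :=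
  ∀ i j : Fin n, i ≠ j → (γ i ∩ γ j).ncard ≤ m

/-- Two curves touch if their intersection is a singleton. -/
def Touches (a b : Set Plane) : Prop := ∃ x, a ∩ b = {x}

/-- The number of touching pairs of the family. -/
def touchingPairs {n : ℕ} (γ : Fin n → Set Plane) : ℕ :=
  {p : Fin n × Fin n | p.1 < p.2 ∧ Touches (γ p.1) (γ p.2)}.ncard

/-- The set of intersection points of the family: points lying on at least two
distinct members. -/
def interPoints {n : ℕ} (γ : Fin n → Set Plane) : Set Plane :=
  {x : Plane | ∃ i j : Fin n, i ≠ j ∧ x ∈ γ i ∧ x ∈ γ j}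

open Complex in
theorem exists_log_of_ne_zero {A : Type*} [TopologicalSpace A] [SimplyConnectedSpace A]
    [LocallyPathConnectedSpace A] (f : C(A, ℂ)) (hf : ∀ a, f a ≠ 0) :
    ∃ L : C(A, ℂ), ∀ a, Complex.exp (L a) = f a := by
  obtain ⟨a₀⟩ : Nonempty A := inferInstance
  obtain ⟨F, ⟨-, hF⟩, -⟩ := isCoveringMapOn_exp.existsUnique_continuousMap_lifts f (a₀ := a₀)
    (e₀ := Complex.log (f a₀)) (Complex.exp_log (hf a₀)) (by simpa using hf)
  exact ⟨F, fun a => congrFun hF a⟩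

theorem jordanArc_isClosed {α : Set Plane} (hα : IsJordanArc α) : IsClosed α := by
  obtain ⟨h⟩ := hα
  have : CompactSpace α := h.symm.compactSpace
  exact (isCompact_iff_compactSpace.mpr this).isClosed

theorem jordanArc_isCompact {α : Set Plane} (hα : IsJordanArc α) : IsCompact α := by
  obtain ⟨h⟩ := hα
  have : CompactSpace α := h.symm.compactSpace
  exact (isCompact_iff_compactSpace.mpr this)

/-- A continuous nonvanishing function has a logarithm along a Jordan arc. -/
theorem jordanArc_exists_log {α : Set Plane} (hα : IsJordanArc α) (f : C(Plane, ℂ))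
    (hf : ∀ z ∈ α, f z ≠ 0) :
    ∃ a : C(Plane, ℂ), ∀ z ∈ α, Complex.exp (a z) = f z := by
  have hcl := jordanArc_isClosed hα
  obtain ⟨h⟩ := hα
  let g : C(ℝ, ℂ) := ⟨fun t => f (h.symm (Set.projIcc 0 1 zero_le_one t)), by
    have : Continuous (Set.projIcc (0 : ℝ) 1 zero_le_one) := continuous_projIcc
    fun_prop⟩
  obtain ⟨L, hL⟩ := exists_log_of_ne_zero g (fun t => hf _ (Subtype.coe_prop _))
  let l : C(α, ℂ) := ⟨fun z => L (h z : ℝ), by fun_prop⟩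
  obtain ⟨a, ha⟩ := ContinuousMap.exists_restrict_eq hcl l
  refine ⟨a, fun z hz => ?_⟩
  have h1 : a z = L (h ⟨z, hz⟩ : ℝ) := congrArg (fun k : C(α, ℂ) => k ⟨z, hz⟩) ha
  rw [h1, hL]
  simp [g]

def planeEquiv : Plane ≃L[ℝ] ℂ := Complex.orthonormalBasisOneI.repr.symm.toContinuousLinearEquiv

/-- Winding number obstruction. -/
theorem winding_eq_zero (G : C(Plane, ℂ)) (hG : ∀ z, G z ≠ 0) (U : Set Plane)
    (hU : Bornology.IsBounded U) (p : Plane) (n : ℤ)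
    (h : ∀ z ∉ U, G z = (planeEquiv z - planeEquiv p) ^ n) : n = 0 := by
  obtain ⟨L, hL⟩ := exists_log_of_ne_zero G hG
  have hb : Bornology.IsBounded (planeEquiv '' U) :=
    hU.image (planeEquiv : Plane →L[ℝ] ℂ)
  obtain ⟨R, hR0, hR⟩ := hb.subset_closedBall_lt 0 (planeEquiv p)
  set c : ℝ → Plane := fun t => planeEquiv.symm
    (planeEquiv p + ((R + 1 : ℝ) : ℂ) * Complex.exp (t * Complex.I)) with hc
  have hcU : ∀ t, c t ∉ U := by
    intro t ht
    have := hR (Set.mem_image_of_mem _ ht)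
    simp [hc, Complex.norm_exp_ofReal_mul_I] at this
    rw [show ((R : ℂ) + 1) = ((R + 1 : ℝ) : ℂ) by push_cast; rfl, Complex.norm_real,
      Real.norm_eq_abs, abs_of_pos (by linarith)] at this
    linarith
  have hcc : Continuous c := by
    rw [hc]; fun_prop
  have hGc : ∀ t : ℝ, Complex.exp (L (c t)) =
      ((R + 1 : ℝ) : ℂ) ^ n * Complex.exp (n * (t * Complex.I)) := by
    intro t
    rw [hL, h _ (hcU t), hc, Complex.exp_int_mul, ← mul_zpow]
    simp
  -- the difference is locally constant
  have hR1 : ((R + 1 : ℝ) : ℂ) ≠ 0 := by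
    exact_mod_cast (by linarith : R + 1 ≠ 0)
  set D : ℝ → ℂ := fun t => L (c t) - n * (t * Complex.I) with hD
  have hDc : Continuous D := by rw [hD]; fun_prop
  have hDe : ∀ t, Complex.exp (D t) = ((R + 1 : ℝ) : ℂ) ^ n := by
    intro t
    rw [hD, Complex.exp_sub, hGc, mul_div_assoc, div_self (Complex.exp_ne_zero _), mul_one]
  have hDconst : D (2 * Real.pi) = D 0 := by
    have key : (fun t => Complex.exp (D t)) = fun t : ℝ => Complex.exp (D 0) := by
      funext t; rw [hDe, hDe]
    have := Complex.isCoveringMap_exp.eq_of_comp_eq (A := ℝ) (g₁ := D) (g₂ := fun _ => D 0)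
      hDc continuous_const (by
        funext t
        exact Subtype.ext (congrFun key t)) 0 rfl
    exact congrFun this _
  have hcp : c (2 * Real.pi) = c 0 := by
    simp [hc]
  rw [hD] at hDconst
  simp only [hcp] at hDconst
  simpa [Real.pi_ne_zero] using hDconst

/-- Independence of the functions `z - p i` modulo functions with a logarithm. -/
theorem exponents_eq_zero {ι : Type*} [Fintype ι] (K : Set Plane) (hK : IsClosed K)
    (U : ι → Set Plane) (hUo : ∀ i, IsOpen (U i)) (hUb : ∀ i, Bornology.IsBounded (U i))
    (hUf : ∀ i, frontier (U i) ⊆ K) (hd : ∀ i j, i ≠ j → Disjoint (U i) (U j))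
    (p : ι → Plane) (hp : ∀ i, p i ∈ U i) (n : ι → ℤ) (F : Plane → ℂ)
    (hF : ContinuousOn F K)
    (h : ∀ z ∈ K, Complex.exp (F z) = ∏ i, (planeEquiv z - planeEquiv (p i)) ^ n i) (i : ι) :
    n i = 0 := by
  classical
  obtain ⟨F', hF'⟩ := ContinuousMap.exists_restrict_eq hK ⟨K.domRestrict F, hF.domRestrict⟩
  have hFF : ∀ z ∈ K, F' z = F z := fun z hz =>
    congrArg (fun k : C(K, ℂ) => k ⟨z, hz⟩) hF'
  have hne : ∀ j ≠ i, ∀ z ∈ closure (U i), planeEquiv z - planeEquiv (p j) ≠ 0 := by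
    intro j hj z hz h0
    have hzp : z = p j := planeEquiv.injective (sub_eq_zero.mp h0)
    have : Disjoint (closure (U i)) (U j) := (hd i j hj.symm).closure_left (hUo j)
    exact Set.disjoint_left.mp this hz (hzp ▸ hp j)
  have hne' : ∀ z ∉ U i, planeEquiv z - planeEquiv (p i) ≠ 0 := by
    intro z hz h0
    exact hz ((planeEquiv.injective (sub_eq_zero.mp h0)) ▸ hp i)
  let A : Plane → ℂ := fun z => Complex.exp (F' z) *
    ∏ j ∈ Finset.univ.erase i, (planeEquiv z - planeEquiv (p j)) ^ (- n j)
  let B : Plane → ℂ := fun z => (planeEquiv z - planeEquiv (p i)) ^ n i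
  have hA : ContinuousOn A (closure (U i)) := by
    refine ContinuousOn.mul (by fun_prop) (continuousOn_finsetProd _ fun j hj => ?_)
    refine ContinuousOn.zpow₀ (by fun_prop) _ fun z hz => Or.inl ?_
    exact hne j (Finset.ne_of_mem_erase hj) z hz
  have hB : ContinuousOn B (closure (U i)ᶜ) := by
    rw [(hUo i).isClosed_compl.closure_eq]
    exact ContinuousOn.zpow₀ (by fun_prop) _ fun z hz => Or.inl (hne' z hz)
  have hAB : ∀ z ∈ frontier (U i), A z = B z := by
    intro z hz
    have hzK := hUf i hz
    simp only [A, B]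
    rw [hFF z hzK, h z hzK, ← Finset.mul_prod_erase _ _ (Finset.mem_univ i), mul_assoc,
      ← Finset.prod_mul_distrib, Finset.prod_eq_one, mul_one]
    intro j hj
    rw [← zpow_add₀ (hne j (Finset.ne_of_mem_erase hj) z (frontier_subset_closure hz))]
    simp
  have hGc : Continuous ((U i).piecewise A B) := continuous_piecewise hAB hA hB
  refine winding_eq_zero ⟨(U i).piecewise A B, hGc⟩ ?_ (U i) (hUb i) (p i) (n i) ?_
  · intro z
    by_cases hz : z ∈ U i
    · simp only [ContinuousMap.coe_mk, Set.piecewise_eq_of_mem _ _ _ hz, A]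
      refine mul_ne_zero (Complex.exp_ne_zero _) (Finset.prod_ne_zero_iff.mpr fun j hj => ?_)
      exact zpow_ne_zero _ (hne j (Finset.ne_of_mem_erase hj) z (subset_closure hz))
    · simp only [ContinuousMap.coe_mk, Set.piecewise_eq_of_notMem _ _ _ hz, B]
      exact zpow_ne_zero _ (hne' z hz)
  · intro z hz
    simp only [ContinuousMap.coe_mk, Set.piecewise_eq_of_notMem _ _ _ hz, B]

theorem card_le_of_two_arcs {ι : Type*} [Fintype ι] {α β : Set Plane} (hα : IsJordanArc α)
    (hβ : IsJordanArc β) (hfin : (α ∩ β).Finite)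
    (U : ι → Set Plane) (hUo : ∀ i, IsOpen (U i)) (hUb : ∀ i, Bornology.IsBounded (U i))
    (hUf : ∀ i, frontier (U i) ⊆ α ∪ β) (hd : ∀ i j, i ≠ j → Disjoint (U i) (U j))
    (p : ι → Plane) (hp : ∀ i, p i ∈ U i) (hpK : ∀ i, p i ∉ α ∪ β) :
    Fintype.card ι ≤ (α ∩ β).ncard := by
  classical
  have hne : ∀ i, ∀ z ∈ α ∪ β, planeEquiv z - planeEquiv (p i) ≠ 0 := by
    intro i z hz h0
    exact hpK i ((planeEquiv.injective (sub_eq_zero.mp h0)) ▸ hz)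
  have hα' := fun i => jordanArc_exists_log hα
    ⟨fun z => planeEquiv z - planeEquiv (p i), by fun_prop⟩ (fun z hz => hne i z (Or.inl hz))
  have hβ' := fun i => jordanArc_exists_log hβ
    ⟨fun z => planeEquiv z - planeEquiv (p i), by fun_prop⟩ (fun z hz => hne i z (Or.inr hz))
  choose a ha using hα'
  choose b hb using hβ'
  simp only [ContinuousMap.coe_mk] at ha hb
  have hv : ∀ i, ∀ x : (α ∩ β : Set Plane), ∃ k : ℤ, a i x = b i x + k * (2 * Real.pi * Complex.I) := by
    intro i x
    exact Complex.exp_eq_exp_iff_exists_int.mp ((ha i x x.2.1).trans (hb i x x.2.2).symm)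
  choose v hv using hv
  have : Fintype (α ∩ β : Set Plane) := hfin.fintype
  have hli : LinearIndependent ℤ v := by
    rw [Fintype.linearIndependent_iff]
    intro n hn i
    have hn' : ∀ x, ∑ i, n i * v i x = 0 := by
      intro x
      have := congrFun hn x
      simpa using this
    let A : Plane → ℂ := fun z => ∑ i, n i * a i z
    let B : Plane → ℂ := fun z => ∑ i, n i * b i z
    have hAB : ∀ z ∈ α ∩ β, A z = B z := by
      intro z hz
      have h1 : ((∑ i, n i * v i ⟨z, hz⟩ : ℤ) : ℂ) = 0 := by rw [hn']; simp
      push_cast at h1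
      have : A z = B z + (∑ i, (n i : ℂ) * v i ⟨z, hz⟩) * (2 * Real.pi * Complex.I) := by
        simp only [A, B]
        rw [Finset.sum_mul, ← Finset.sum_add_distrib]
        refine Finset.sum_congr rfl fun j _ => ?_
        rw [hv j ⟨z, hz⟩]
        ring
      rw [this, h1]; simp
    have hA : Continuous A := by fun_prop
    have hB : Continuous B := by fun_prop
    have hFB : ∀ z ∈ β, α.piecewise A B z = B z := by
      intro z hz
      by_cases hza : z ∈ α
      · rw [Set.piecewise_eq_of_mem _ _ _ hza, hAB z ⟨hza, hz⟩]
      · rw [Set.piecewise_eq_of_notMem _ _ _ hza]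
    have hFA : ∀ z ∈ α, α.piecewise A B z = A z := fun z hz => Set.piecewise_eq_of_mem _ _ _ hz
    have hF : ContinuousOn (α.piecewise A B) (α ∪ β) :=
      ContinuousOn.union_of_isClosed (hA.continuousOn.congr hFA) (hB.continuousOn.congr hFB)
        (jordanArc_isClosed hα) (jordanArc_isClosed hβ)
    refine exponents_eq_zero (α ∪ β) ((jordanArc_isClosed hα).union (jordanArc_isClosed hβ)) U hUo
      hUb hUf hd p hp n _ hF ?_ i
    rintro z (hz | hz)
    · rw [hFA z hz, Complex.exp_sum]
      exact Finset.prod_congr rfl fun j _ => by rw [Complex.exp_int_mul, ha j z hz]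
    · rw [hFB z hz, Complex.exp_sum]
      exact Finset.prod_congr rfl fun j _ => by rw [Complex.exp_int_mul, hb j z hz]
  have := hli.fintype_card_le_finrank
  rwa [Module.finrank_fintype_fun_eq_card, ← Nat.card_eq_fintype_card (α := (α ∩ β : Set Plane)),
    Nat.card_coe_set_eq] at this

theorem frontier_component_subset {K : Set Plane} (hK : IsClosed K) (p : Plane) :
    frontier (connectedComponentIn Kᶜ p) ⊆ K := by
  intro z hz
  by_contra hzK
  have ho : IsOpen (connectedComponentIn Kᶜ z) := hK.isOpen_compl.connectedComponentIn
  have hzz : z ∈ connectedComponentIn Kᶜ z := mem_connectedComponentIn hzK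
  obtain ⟨w, hw1, hw2⟩ := mem_closure_iff.mp (frontier_subset_closure hz) _ ho hzz
  have e1 := connectedComponentIn_eq hw1
  have e2 := connectedComponentIn_eq hw2
  have hop : IsOpen (connectedComponentIn Kᶜ p) := hK.isOpen_compl.connectedComponentIn
  rw [frontier, hop.interior_eq, e2, ← e1] at hz
  exact hz.2 hzz

theorem isPreconnected_compl_closedBall_plane (R : ℝ) (hR : 0 ≤ R) :
    IsPreconnected (Metric.closedBall (0 : Plane) R)ᶜ := by
  have hrank : 1 < Module.rank ℝ Plane := by
    rw [rank_eq_card_basis (EuclideanSpace.basisFun (Fin 2) ℝ).toBasis]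
    norm_num
  have hB : IsPreconnected ({0}ᶜ : Set Plane) :=
    (isConnected_compl_singleton_of_one_lt_rank hrank 0).isPreconnected
  let f : Plane → Plane := fun y => (1 + R * ‖y‖⁻¹) • y
  have hf : ContinuousOn f {0}ᶜ := by
    intro y hy
    have hy' : ‖y‖ ≠ 0 := by simpa using hy
    refine ContinuousAt.continuousWithinAt ?_
    exact (continuousAt_const.add (continuousAt_const.mul
      (ContinuousAt.inv₀ continuousAt_id.norm hy'))).smul continuousAt_id
  have himg : f '' {0}ᶜ = (Metric.closedBall (0 : Plane) R)ᶜ := by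
    apply Set.Subset.antisymm
    · rintro - ⟨y, hy, rfl⟩
      have hy' : 0 < ‖y‖ := by simpa using hy
      have h1 : 0 ≤ R * ‖y‖⁻¹ := by positivity
      have : ‖f y‖ = ‖y‖ + R := by
        simp only [f, norm_smul, Real.norm_eq_abs]
        rw [abs_of_nonneg (by linarith)]
        field_simp
      simp only [Set.mem_compl_iff, mem_closedBall_zero_iff, this]
      linarith
    · intro y hy
      have hyR : R < ‖y‖ := by simpa using hy
      have hy0 : 0 < ‖y‖ := lt_of_le_of_lt hR hyR
      have hpos : 0 < 1 - R * ‖y‖⁻¹ := by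
        rw [← div_eq_mul_inv, sub_pos, div_lt_one hy0]
        exact hyR
      have hn : ‖(1 - R * ‖y‖⁻¹) • y‖ = ‖y‖ - R := by
        rw [norm_smul, Real.norm_eq_abs, abs_of_pos hpos]
        field_simp
      have hd : ‖y‖ - R ≠ 0 := by linarith
      refine ⟨(1 - R * ‖y‖⁻¹) • y, ?_, ?_⟩
      · have : ‖(1 - R * ‖y‖⁻¹) • y‖ ≠ 0 := by rw [hn]; exact hd
        simpa only [Set.mem_compl_iff, Set.mem_singleton_iff, norm_ne_zero_iff] using this
      · simp only [f]
        rw [hn, smul_smul]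
        have : (1 + R * (‖y‖ - R)⁻¹) * (1 - R * ‖y‖⁻¹) = 1 := by
          field_simp
          ring
        rw [this, one_smul]
  rw [← himg]
  exact hB.image f hf

theorem unbounded_component_unique {K : Set Plane} (hK : IsCompact K) (p q : Plane)
    (hp : ¬ Bornology.IsBounded (connectedComponentIn Kᶜ p))
    (hq : ¬ Bornology.IsBounded (connectedComponentIn Kᶜ q)) :
    connectedComponentIn Kᶜ p = connectedComponentIn Kᶜ q := by
  obtain ⟨R, hR0, hR⟩ := hK.isBounded.subset_closedBall_lt 0 (0 : Plane)
  have hc := isPreconnected_compl_closedBall_plane R hR0.le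
  have hsub : (Metric.closedBall (0 : Plane) R)ᶜ ⊆ Kᶜ := Set.compl_subset_compl.mpr hR
  have key : ∀ r, ¬ Bornology.IsBounded (connectedComponentIn Kᶜ r) →
      ∃ w ∈ (Metric.closedBall (0 : Plane) R)ᶜ, w ∈ connectedComponentIn Kᶜ r := by
    intro r hr
    by_contra hcon
    push Not at hcon
    refine hr ((Metric.isBounded_closedBall (x := (0 : Plane)) (r := R)).subset ?_)
    intro w hw
    by_contra hw'
    exact hcon w hw' hw
  obtain ⟨w, hw, hwp⟩ := key p hp
  obtain ⟨w', hw', hwq⟩ := key q hq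
  rw [connectedComponentIn_eq hwp, connectedComponentIn_eq hwq]
  exact connectedComponentIn_eq (hc.subset_connectedComponentIn hw hsub hw')

/-- Two distinct Jordan arcs intersecting in at most `m` points cut the plane into at
most `m + 2` connected components. -/
theorem complement_two_jordan_arcs_components (m : ℕ)
    (α β : Set Plane)
    (hα : IsJordanArc α) (hβ : IsJordanArc β) (hne : α ≠ β)
    (hfin : (α ∩ β).Finite) (hcard : (α ∩ β).ncard ≤ m) :
    {Δ : Set Plane | ∃ p ∈ (α ∪ β)ᶜ, Δ = connectedComponentIn ((α ∪ β)ᶜ) p}.Finite ∧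
    {Δ : Set Plane | ∃ p ∈ (α ∪ β)ᶜ, Δ = connectedComponentIn ((α ∪ β)ᶜ) p}.ncard ≤
      m + 2 := by
  classical
  have hKc : IsCompact (α ∪ β) := (jordanArc_isCompact hα).union (jordanArc_isCompact hβ)
  set S := {Δ : Set Plane | ∃ p ∈ (α ∪ β)ᶜ, Δ = connectedComponentIn ((α ∪ β)ᶜ) p} with hS
  set T := {Δ ∈ S | Bornology.IsBounded Δ} with hT
  set V := {Δ ∈ S | ¬ Bornology.IsBounded Δ} with hV
  have hSTV : S ⊆ T ∪ V := fun Δ hΔ => by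
    by_cases hb : Bornology.IsBounded Δ
    · exact Or.inl ⟨hΔ, hb⟩
    · exact Or.inr ⟨hΔ, hb⟩
  have hVs : V.encard ≤ 1 := by
    rw [Set.encard_le_one_iff]
    rintro _ _ ⟨⟨p, hp, rfl⟩, hpb⟩ ⟨⟨q, hq, rfl⟩, hqb⟩
    exact unbounded_component_unique hKc p q hpb hqb
  have hTs : T.encard ≤ m := by
    by_contra hcon
    push Not at hcon
    obtain ⟨t, htT, htc⟩ := Set.exists_subset_encard_eq (Order.add_one_le_of_lt hcon)
    have htf : t.Finite := Set.finite_of_encard_eq_coe (k := m + 1) (by exact_mod_cast htc)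
    have : Fintype t := htf.fintype
    choose! p hp hpe using fun Δ (hΔ : Δ ∈ S) => hΔ
    have hle := card_le_of_two_arcs (ι := t) hα hβ hfin (fun i => i.1)
      (fun i => by
        rw [hpe i.1 (htT i.2).1]
        exact hKc.isClosed.isOpen_compl.connectedComponentIn)
      (fun i => (htT i.2).2)
      (fun i => by
        rw [hpe i.1 (htT i.2).1]
        exact frontier_component_subset hKc.isClosed _)
      (fun i j hij => by
        rw [Set.disjoint_left]
        intro w hwi hwj
        apply hij
        apply Subtype.ext
        rw [hpe i.1 (htT i.2).1] at hwi
        rw [hpe j.1 (htT j.2).1] at hwj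
        rw [hpe i.1 (htT i.2).1, hpe j.1 (htT j.2).1, connectedComponentIn_eq hwi,
          connectedComponentIn_eq hwj])
      (fun i => p i.1)
      (fun i => by
        have h1 := mem_connectedComponentIn (hp i.1 (htT i.2).1)
        rwa [← hpe i.1 (htT i.2).1] at h1)
      (fun i => hp i.1 (htT i.2).1)
    have h2 : Fintype.card t = m + 1 := by
      rw [← Nat.card_eq_fintype_card, Nat.card_coe_set_eq, Set.ncard, htc]
      norm_cast
    omega
  have hle : S.encard ≤ ((m + 2 : ℕ) : ℕ∞) := by
    calc S.encard ≤ (T ∪ V).encard := Set.encard_le_encard hSTV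
      _ ≤ T.encard + V.encard := Set.encard_union_le _ _
      _ ≤ m + 1 := add_le_add hTs hVs
      _ ≤ ((m + 2 : ℕ) : ℕ∞) := by norm_cast; omega
  have hSf : S.Finite := Set.finite_of_encard_le_coe hle
  refine ⟨hSf, ?_⟩
  rw [← hSf.cast_ncard_eq] at hle
  exact_mod_cast hle
end
end

section
/- Let m ≥ 1 and let γ₁,…,γₙ (n ≥ 1) be an m-intersecting family of n closed Jordan curves in general position in the plane. Then the complement ℝ² \ (γ₁ ∪ ⋯ ∪ γₙ) has at most m·n·(n−1)/2 + n + 1 connected components. -/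
noncomputable section

open Complex in
lemma afb_exists_log {X : Type*} [TopologicalSpace X] [SimplyConnectedSpace X]
    [LocallyPathConnectedSpace X] (h : C(X, ℂ)) (h0 : ∀ x, h x ≠ 0) :
    ∃ H : C(X, ℂ), ∀ x, Complex.exp (H x) = h x := by
  obtain ⟨a⟩ : Nonempty X := inferInstance
  obtain ⟨H, ⟨-, hH⟩, -⟩ := Complex.isCoveringMapOn_exp.existsUnique_continuousMap_lifts h
    (a₀ := a) (e₀ := Complex.log (h a)) (Complex.exp_log (h0 a)) (fun x => h0 x)
  exact ⟨H, fun x => congrFun hH x⟩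

/-- Identification of the plane with the complex numbers. -/
def afbE : Plane ≃ₗᵢ[ℝ] ℂ := Complex.orthonormalBasisOneI.repr.symm

lemma afb_continuous_E : Continuous afbE := afbE.continuous

lemma afb_comp_eq {A : Set Plane} {x y z : Plane}
    (hx : z ∈ connectedComponentIn Aᶜ x) (hy : z ∈ connectedComponentIn Aᶜ y) :
    connectedComponentIn Aᶜ x = connectedComponentIn Aᶜ y :=
  (connectedComponentIn_eq hx).trans (connectedComponentIn_eq hy).symm

lemma afb_frontier {A : Set Plane} (hA : IsCompact A) (p : Plane) :
    frontier (connectedComponentIn Aᶜ p) ⊆ A := by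
  intro x hx
  by_contra hxA
  have ho : IsOpen (connectedComponentIn Aᶜ p) := hA.isClosed.isOpen_compl.connectedComponentIn
  have hox : IsOpen (connectedComponentIn Aᶜ x) := hA.isClosed.isOpen_compl.connectedComponentIn
  have hxx : x ∈ connectedComponentIn Aᶜ x := mem_connectedComponentIn hxA
  rw [ho.frontier_eq] at hx
  obtain ⟨z, hz1, hz2⟩ := mem_closure_iff.1 hx.1 _ hox hxx
  rw [afb_comp_eq hz1 hz2] at hxx
  exact hx.2 hxx

/-- A nonvanishing continuous function on the plane cannot agree with a nonzero power
near infinity. -/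
lemma afb_winding (h : C(Plane, ℂ)) (h0 : ∀ x, h x ≠ 0) (p : Plane) (n : ℤ) (R : ℝ) (hR : 0 < R)
    (hh : ∀ z, ‖z - p‖ = R → h z = (afbE z - afbE p) ^ n) : n = 0 := by
  obtain ⟨H, hH⟩ := afb_exists_log h h0
  let c : ℝ → Plane := fun θ => afbE.symm (afbE p + R * Complex.exp (θ * Complex.I))
  have hc : Continuous c := by
    apply afbE.symm.continuous.comp; fun_prop
  have hEc : ∀ θ, afbE (c θ) - afbE p = R * Complex.exp (θ * Complex.I) := by
    intro θ; simp [c]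
  have hn : ∀ θ, ‖c θ - p‖ = R := by
    intro θ
    rw [← afbE.norm_map, map_sub, hEc, norm_mul, Complex.norm_exp_ofReal_mul_I]
    simp [abs_of_pos hR]
  have hRlog : Complex.exp (Real.log R : ℝ) = R := by
    rw [← Complex.ofReal_exp, Real.exp_log hR]
  -- the difference of logarithms
  let g : ℝ → ℂ := fun θ => H (c θ) - n * (Real.log R + θ * Complex.I)
  have hg : Continuous g := by
    have : Continuous fun θ => H (c θ) := H.continuous.comp hc
    fun_prop
  have hexp : ∀ θ, Complex.exp (g θ) = 1 := by
    intro θ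
    have : Complex.exp (n * (Real.log R + θ * Complex.I)) = (afbE (c θ) - afbE p) ^ n := by
      rw [Complex.exp_int_mul, Complex.exp_add, hRlog, hEc]
    simp only [g]
    rw [Complex.exp_sub, this, hH, hh _ (hn θ), div_self]
    rw [← hh _ (hn θ)]; exact h0 _
  have hval : ∀ θ, ∃ k : ℤ, g θ = k * (2 * Real.pi * Complex.I) := fun θ =>
    Complex.exp_eq_one_iff.1 (hexp θ)
  choose k hk using hval
  have hkc : Continuous fun θ => ((k θ : ℤ) : ℝ) := by
    have : (fun θ => ((k θ : ℤ) : ℝ)) = fun θ => (g θ).im / (2 * Real.pi) := by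
      funext θ
      rw [hk θ]
      have := Real.pi_pos
      simp
    rw [this]
    fun_prop
  have hkc' : Continuous k := by
    have := Int.isClosedEmbedding_coe_real.isInducing.continuous_iff (f := k)
    exact this.2 hkc
  have hconst : k 0 = k (2 * Real.pi) :=
    PreconnectedSpace.constant inferInstance hkc'
  have h1 : g 0 = g (2 * Real.pi) := by rw [hk, hk, hconst]
  have hc0 : c 0 = c (2 * Real.pi) := by
    simp only [c]
    push_cast
    rw [Complex.exp_two_pi_mul_I]; simp
  simp only [g, hc0] at h1
  have h2 : (n : ℂ) * (2 * Real.pi * Complex.I) = 0 := by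
    push_cast at h1
    linear_combination h1
  have := Complex.two_pi_I_ne_zero
  simpa using (mul_eq_zero.1 h2).resolve_right this

open Classical in
lemma afb_eilenberg {ι : Type*} [Fintype ι] (A : Set Plane) (hA : IsCompact A) (p : ι → Plane)
    (hp : ∀ k, p k ∉ A)
    (hb : ∀ k, Bornology.IsBounded (connectedComponentIn Aᶜ (p k)))
    (hd : ∀ k l, connectedComponentIn Aᶜ (p k) = connectedComponentIn Aᶜ (p l) → k = l)
    (n : ι → ℤ) (F : C(A, ℂ))
    (hF : ∀ z : A, Complex.exp (F z) = ∏ k, (afbE z - afbE (p k)) ^ n k) : n = 0 := by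
  funext k₀
  obtain ⟨G, hG⟩ := F.exists_restrict_eq hA.isClosed
  have hG' : ∀ z (hz : z ∈ A), G z = F ⟨z, hz⟩ := fun z hz => by rw [← hG]; rfl
  set U := connectedComponentIn Aᶜ (p k₀) with hU
  have hUo : IsOpen U := hA.isClosed.isOpen_compl.connectedComponentIn
  have hpU : p k₀ ∈ U := mem_connectedComponentIn (hp k₀)
  let f : Plane → ℂ := fun z =>
    Complex.exp (G z) / ∏ k ∈ Finset.univ.erase k₀, (afbE z - afbE (p k)) ^ n k
  let g : Plane → ℂ := fun z => (afbE z - afbE (p k₀)) ^ n k₀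
  have hcl : ∀ k ≠ k₀, p k ∉ closure U := by
    intro k hk hcl
    obtain ⟨z, hz1, hz2⟩ := mem_closure_iff.1 hcl _
      (hA.isClosed.isOpen_compl.connectedComponentIn (x := p k)) (mem_connectedComponentIn (hp k))
    exact hk (hd _ _ (afb_comp_eq hz1 hz2))
  have hne : ∀ z ∈ closure U, ∀ k ≠ k₀, afbE z - afbE (p k) ≠ 0 := by
    intro z hz k hk h
    have : z = p k := afbE.injective (sub_eq_zero.1 h)
    exact hcl k hk (this ▸ hz)
  have hprod : ∀ z ∈ closure U,
      ∏ k ∈ Finset.univ.erase k₀, (afbE z - afbE (p k)) ^ n k ≠ 0 := by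
    intro z hz
    exact Finset.prod_ne_zero_iff.2 fun k hk =>
      zpow_ne_zero _ (hne z hz k (Finset.ne_of_mem_erase hk))
  have hne' : ∀ z, z ∉ U → afbE z - afbE (p k₀) ≠ 0 := by
    intro z hz h
    have : z = p k₀ := afbE.injective (sub_eq_zero.1 h)
    exact hz (this ▸ hpU)
  have hf : ContinuousOn f (closure U) := by
    refine ContinuousOn.div (by fun_prop) ?_ hprod
    refine continuousOn_finsetProd _ fun k hk => ?_
    refine ContinuousOn.zpow₀ ?_ _ fun z hz => Or.inl (hne z hz k (Finset.ne_of_mem_erase hk))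
    exact (afb_continuous_E.sub continuous_const).continuousOn
  have hg : ContinuousOn g (closure Uᶜ) := by
    rw [hUo.isClosed_compl.closure_eq]
    refine ContinuousOn.zpow₀ ?_ _ fun z hz => Or.inl (hne' z hz)
    exact (afb_continuous_E.sub continuous_const).continuousOn
  have hfg : ∀ z ∈ frontier U, f z = g z := by
    intro z hz
    have hzA : z ∈ A := afb_frontier hA _ hz
    simp only [f, g]
    rw [div_eq_iff (hprod z (frontier_subset_closure hz)), hG' z hzA, hF ⟨z, hzA⟩,
      Finset.mul_prod_erase Finset.univ (fun k => (afbE z - afbE (p k)) ^ n k)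
      (Finset.mem_univ k₀)]
  have hcont : Continuous (U.piecewise f g) := continuous_piecewise hfg hf hg
  obtain ⟨R, hR⟩ := (hb k₀).subset_ball (p k₀)
  have hR0 : 0 < R := by
    have := hR hpU
    simpa using this
  refine afb_winding ⟨_, hcont⟩ ?_ (p k₀) (n k₀) R hR0 ?_
  · intro z
    change U.piecewise f g z ≠ 0
    by_cases hz : z ∈ U
    · rw [Set.piecewise_eq_of_mem _ _ _ hz]
      exact div_ne_zero (Complex.exp_ne_zero _) (hprod z (subset_closure hz))
    · rw [Set.piecewise_eq_of_notMem _ _ _ hz]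
      exact zpow_ne_zero _ (hne' z hz)
  · intro z hz
    change U.piecewise f g z = _
    rw [Set.piecewise_eq_of_notMem]
    intro hzU
    have := hR hzU
    rw [mem_ball_iff_norm] at this
    linarith

/-- Unbounded components of the complement of a compact set coincide. -/
lemma afb_unbounded {A : Set Plane} (hA : IsCompact A) {x y : Plane}
    (hx : ¬ Bornology.IsBounded (connectedComponentIn Aᶜ x))
    (hy : ¬ Bornology.IsBounded (connectedComponentIn Aᶜ y)) :
    connectedComponentIn Aᶜ x = connectedComponentIn Aᶜ y := by
  obtain ⟨R, hR0, hR⟩ := hA.isBounded.subset_closedBall_lt 0 (0 : Plane)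
  let V : Set Plane := (fun q : ℝ × ℝ => afbE.symm (q.1 * Complex.exp (q.2 * Complex.I))) ''
    (Set.Ioi R ×ˢ Set.univ)
  have hV : IsPreconnected V := by
    refine IsPreconnected.image (isPreconnected_Ioi.prod isPreconnected_univ) _ ?_
    exact (afbE.symm.continuous.comp (by fun_prop)).continuousOn
  have hVmem : ∀ z, z ∈ V ↔ R < ‖z‖ := by
    intro z
    constructor
    · rintro ⟨⟨r, θ⟩, ⟨hr, -⟩, rfl⟩
      have hr' : R < r := hr
      simp only [LinearIsometryEquiv.norm_map, norm_mul, Complex.norm_exp_ofReal_mul_I]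
      simp [abs_of_pos (hR0.trans hr'), hr']
    · intro hz
      refine ⟨(‖afbE z‖, Complex.arg (afbE z)), ⟨by simpa using hz, trivial⟩, ?_⟩
      simp only [Complex.norm_mul_exp_arg_mul_I, LinearIsometryEquiv.symm_apply_apply]
  have hVA : V ⊆ Aᶜ := by
    intro z hz hzA
    have := hR hzA
    rw [hVmem] at hz
    simp at this
    linarith
  have key : ∀ x, ¬ Bornology.IsBounded (connectedComponentIn Aᶜ x) →
      V ⊆ connectedComponentIn Aᶜ x := by
    intro x hx
    obtain ⟨z, hz, hzR⟩ : ∃ z ∈ connectedComponentIn Aᶜ x, R < ‖z‖ := by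
      by_contra! hcon
      exact hx ((Metric.isBounded_closedBall (x := (0 : Plane)) (r := R)).subset
        fun z hz => by simpa using hcon z hz)
    rw [connectedComponentIn_eq hz]
    exact hV.subset_connectedComponentIn ((hVmem z).2 hzR) hVA
  obtain ⟨z, hz⟩ : V.Nonempty :=
    ⟨_, (R + 1, 0), ⟨by simp, trivial⟩, rfl⟩
  exact afb_comp_eq (key x hx hz) (key y hy hz)

open unitInterval in
lemma afb_param {γ : Set Plane} (h : IsJordanCurve γ) :
    ∃ c : C(I, Plane), Set.range c = γ ∧ c 0 = c 1 ∧
      ∀ s t, c s = c t → s = t ∨ (s = 0 ∧ t = 1) ∨ (s = 1 ∧ t = 0) := by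
  obtain ⟨e⟩ := h
  have hmem : ∀ t : I, afbE.symm (Complex.exp ((2 * Real.pi * t : ℝ) * Complex.I)) ∈
      Metric.sphere (0 : Plane) 1 := by
    intro t
    rw [mem_sphere_zero_iff_norm, LinearIsometryEquiv.norm_map, Complex.norm_exp_ofReal_mul_I]
  let u : I → Metric.sphere (0 : Plane) 1 := fun t => ⟨_, hmem t⟩
  have hu : Continuous u := by
    refine Continuous.subtype_mk (afbE.symm.continuous.comp ?_) _
    fun_prop
  refine ⟨⟨fun t => (e.symm (u t) : Plane), by fun_prop⟩, ?_, ?_, ?_⟩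
  · ext z
    constructor
    · rintro ⟨t, rfl⟩
      exact (e.symm (u t)).2
    · intro hz
      let w := afbE (e ⟨z, hz⟩ : Plane)
      have hw : ‖w‖ = 1 := by
        simp only [w, LinearIsometryEquiv.norm_map]
        simp
      obtain ⟨t, ht⟩ : ∃ t : I, u t = e ⟨z, hz⟩ := by
        have hpi := Real.pi_pos
        obtain ⟨θ, hθ, hwθ⟩ : ∃ θ : ℝ, (0 ≤ θ ∧ θ ≤ 2 * Real.pi) ∧
            Complex.exp (θ * Complex.I) = w := by
          have hw' : Complex.exp (Complex.arg w * Complex.I) = w := by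
            have := Complex.norm_mul_exp_arg_mul_I w
            rwa [hw, Complex.ofReal_one, one_mul] at this
          rcases le_or_gt 0 (Complex.arg w) with h | h
          · exact ⟨_, ⟨h, by linarith [Complex.arg_le_pi w]⟩, hw'⟩
          · refine ⟨Complex.arg w + 2 * Real.pi,
              ⟨by linarith [Complex.neg_pi_lt_arg w], by linarith⟩, ?_⟩
            push_cast
            rw [add_mul, Complex.exp_add, Complex.exp_two_pi_mul_I, mul_one, hw']
        refine ⟨⟨θ / (2 * Real.pi), ⟨by have := hθ.1; positivity, ?_⟩⟩, ?_⟩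
        · rw [div_le_one (by positivity)]; exact hθ.2
        · apply Subtype.ext
          simp only [u]
          rw [mul_div_cancel₀ _ (by positivity), hwθ]
          simp [w]
      refine ⟨t, ?_⟩
      change ((e.symm (u t) : γ) : Plane) = z
      rw [ht]; simp
  · have : u 0 = u 1 := by
      apply Subtype.ext
      simp [u, Complex.exp_two_pi_mul_I]
    change ((e.symm (u 0) : γ) : Plane) = (e.symm (u 1) : γ)
    rw [this]
  · intro s t hst
    have h1 : u s = u t := e.symm.injective (Subtype.ext hst)
    have h2 := afbE.symm.injective (congrArg Subtype.val h1)
    obtain ⟨k, hk⟩ := Complex.exp_eq_exp_iff_exists_int.1 h2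
    have hpi := Real.pi_pos
    have h3 : (s : ℝ) = t + k := by
      have := congrArg Complex.im hk
      simp at this
      have h4 : (2 * Real.pi) * ((s : ℝ) - t - k) = 0 := by linarith
      have := (mul_eq_zero.1 h4).resolve_left (by positivity)
      linarith
    have hs0 := s.2.1
    have hs1 := s.2.2
    have ht0 := t.2.1
    have ht1 := t.2.2
    have hk1 : (k : ℝ) ≤ 1 := by linarith
    have hk2 : (-1 : ℝ) ≤ k := by linarith
    have hk1' : k ≤ 1 := by exact_mod_cast hk1
    have hk2' : -1 ≤ k := by exact_mod_cast hk2
    obtain rfl | rfl | rfl : k = -1 ∨ k = 0 ∨ k = 1 := by omega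
    · right; left
      push_cast at h3
      exact ⟨Subtype.ext (by change (_ : ℝ) = 0; linarith),
        Subtype.ext (by change (_ : ℝ) = 1; linarith)⟩
    · left; apply Subtype.ext; simpa using h3
    · right; right
      push_cast at h3
      exact ⟨Subtype.ext (by change (_ : ℝ) = 1; linarith),
        Subtype.ext (by change (_ : ℝ) = 0; linarith)⟩

lemma afb_kernel {ρ κ : Type*} [Fintype ρ] [Fintype κ] (h : Fintype.card ρ < Fintype.card κ)
    (M : ρ → κ → ℤ) : ∃ v : κ → ℤ, v ≠ 0 ∧ ∀ r, ∑ k, v k * M r k = 0 := by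
  by_contra! hcon
  have hli : LinearIndependent ℤ (fun k : κ => fun r : ρ => M r k) := by
    rw [Fintype.linearIndependent_iff]
    intro v hv
    by_contra hne
    obtain ⟨r, hr⟩ := hcon v (fun h0 => hne (fun i => by simp [h0]))
    apply hr
    have := congrFun hv r
    simpa using this
  have := hli.fintype_card_le_finrank
  simp at this
  omega

lemma afb_card_pairs (n : ℕ) : Fintype.card {q : Fin n × Fin n // q.1 < q.2} = n.choose 2 := by
  rw [Fintype.card_subtype, Finset.card_filter, ← Finset.univ_product_univ,
    Finset.sum_product_right]
  have : ∀ j : Fin n, (∑ i : Fin n, if i < j then 1 else 0) = (j : ℕ) := by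
    intro j
    rw [← Finset.card_filter]
    have h : Finset.univ.filter (fun i => i < j) = Finset.Iio j := by ext; simp
    rw [h, Fin.card_Iio]
  rw [Finset.sum_congr rfl (fun j _ => this j)]
  rw [Fin.sum_univ_eq_sum_range (fun i => i) n, Finset.sum_range_id, Nat.choose_two_right]

open unitInterval in
lemma afb_log_path (h : C(I, ℂ)) (h0 : ∀ x, h x ≠ 0) :
    ∃ H : C(I, ℂ), ∀ x, Complex.exp (H x) = h x := by
  obtain ⟨H, hH⟩ := afb_exists_log
    (h.comp ⟨Set.projIcc (0 : ℝ) 1 zero_le_one, continuous_projIcc⟩) (fun x => h0 _)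
  refine ⟨H.comp ⟨Subtype.val, continuous_subtype_val⟩, fun x => ?_⟩
  simp [hH]

open Classical unitInterval in
set_option maxHeartbeats 1000000 in
lemma afb_bounded_count (m n : ℕ) (γ : Fin n → Set Plane)
    (hcurve : ∀ i, IsJordanCurve (γ i))
    (hfin : ∀ i j : Fin n, i ≠ j → (γ i ∩ γ j).Finite)
    (hint : MIntersecting m γ) (hA : IsCompact (⋃ i, γ i))
    {ι : Type*} [Fintype ι] (p : ι → Plane) (hp : ∀ k, p k ∉ ⋃ i, γ i)
    (hb : ∀ k, Bornology.IsBounded (connectedComponentIn (⋃ i, γ i)ᶜ (p k)))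
    (hd : ∀ k l, connectedComponentIn (⋃ i, γ i)ᶜ (p k) =
      connectedComponentIn (⋃ i, γ i)ᶜ (p l) → k = l) :
    Fintype.card ι ≤ n + n.choose 2 * m := by
  by_contra! hlt
  choose c hcr hc01 hci using fun i => afb_param (hcurve i)
  have hcmem : ∀ i t, c i t ∈ γ i := fun i t => hcr i ▸ Set.mem_range_self t
  have hlog : ∀ i k, ∃ f : C(I, ℂ), ∀ t, Complex.exp (f t) = afbE (c i t) - afbE (p k) := by
    intro i k
    refine afb_log_path ⟨fun t => afbE (c i t) - afbE (p k), ?_⟩ ?_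
    · exact (afb_continuous_E.comp (c i).continuous).sub continuous_const
    · intro t h
      have : c i t = p k := afbE.injective (sub_eq_zero.1 h)
      exact hp k (this ▸ Set.mem_iUnion.2 ⟨i, hcmem i t⟩)
  choose f hf using hlog
  have hτ : ∀ i x, ∃ t, x ∈ γ i → c i t = x := by
    intro i x
    by_cases hx : x ∈ γ i
    · rw [← hcr i] at hx
      obtain ⟨t, ht⟩ := hx
      exact ⟨t, fun _ => ht⟩
    · exact ⟨0, fun h => absurd h hx⟩
  choose τ hτ using hτ
  have hW : ∀ i k, ∃ w : ℤ, f i k 0 = f i k 1 + w * (2 * Real.pi * Complex.I) := fun i k =>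
    Complex.exp_eq_exp_iff_exists_int.1 (by rw [hf, hf, hc01])
  choose W hW using hW
  let P := {q : Fin n × Fin n // q.1 < q.2}
  let Q := Σ q : P, ↥(γ q.1.1 ∩ γ q.1.2)
  have hD : ∀ (r : Q) k, ∃ w : ℤ, f r.1.1.1 k (τ r.1.1.1 r.2) =
      f r.1.1.2 k (τ r.1.1.2 r.2) + w * (2 * Real.pi * Complex.I) := fun r k =>
    Complex.exp_eq_exp_iff_exists_int.1 (by rw [hf, hf, hτ _ _ r.2.2.1, hτ _ _ r.2.2.2])
  choose D hD using hD
  have : ∀ q : P, Fintype ↥(γ q.1.1 ∩ γ q.1.2) := fun q => (hfin _ _ q.2.ne).fintype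
  have hP : Fintype.card P = n.choose 2 := afb_card_pairs n
  have hcardQ : Fintype.card Q ≤ n.choose 2 * m := by
    rw [Fintype.card_sigma, ← hP]
    refine (Finset.sum_le_card_nsmul _ _ m fun q _ => ?_).trans (by simp)
    rw [← Nat.card_eq_fintype_card]
    exact hint _ _ q.2.ne
  have hcard : Fintype.card (Fin n ⊕ Q) < Fintype.card ι := by
    rw [Fintype.card_sum, Fintype.card_fin]; omega
  obtain ⟨v, hv0, hv⟩ := afb_kernel hcard (Sum.elim W D)
  let F : Fin n → I → ℂ := fun i t => ∑ k, (v k : ℂ) * f i k t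
  have hFc : ∀ i, Continuous (F i) := by
    intro i; simp only [F]; fun_prop
  have hsum : ∀ (a b : ι → ℂ) (w : ι → ℤ), (∀ k, a k = b k + w k * (2 * Real.pi * Complex.I)) →
      ∑ k, v k * w k = 0 → ∑ k, (v k : ℂ) * a k = ∑ k, (v k : ℂ) * b k := by
    intro a b w hab hw
    have hw' : ∑ k, (v k : ℂ) * w k = 0 := by exact_mod_cast hw
    simp only [hab, mul_add, Finset.sum_add_distrib, ← mul_assoc]
    simp only [← Finset.sum_mul, hw']
    simp
  have hF01 : ∀ i, F i 0 = F i 1 := fun i =>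
    hsum _ _ (W i) (hW i) (hv (Sum.inl i))
  have hFD : ∀ (r : Q), F r.1.1.1 (τ r.1.1.1 r.2) = F r.1.1.2 (τ r.1.1.2 r.2) := fun r =>
    hsum _ _ (D r) (hD r) (hv (Sum.inr r))
  have hFsame : ∀ i s t, c i s = c i t → F i s = F i t := by
    intro i s t h
    rcases hci i s t h with rfl | ⟨rfl, rfl⟩ | ⟨rfl, rfl⟩
    · rfl
    · exact hF01 i
    · exact (hF01 i).symm
  have hFτ : ∀ i s, F i s = F i (τ i (c i s)) := fun i s =>
    hFsame i _ _ (hτ i _ (hcmem i s)).symm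
  have hFlt : ∀ i j s t, i < j → c i s = c j t → F i s = F j t := by
    intro i j s t hij h
    rw [hFτ i s, hFτ j t, ← h]
    exact hFD ⟨⟨(i, j), hij⟩, ⟨c i s, hcmem i s, h ▸ hcmem j t⟩⟩
  have hFall : ∀ i j s t, c i s = c j t → F i s = F j t := by
    intro i j s t h
    rcases lt_trichotomy i j with hij | rfl | hij
    · exact hFlt i j s t hij h
    · exact hFsame i s t h
    · exact (hFlt j i t s hij h.symm).symm
  let q : C((_ : Fin n) × I, ↥(⋃ i, γ i)) :=
    ⟨fun a => ⟨c a.1 a.2, Set.mem_iUnion.2 ⟨a.1, hcmem a.1 a.2⟩⟩, by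
      refine Continuous.subtype_mk (continuous_sigma fun i => (c i).continuous) _⟩
  have hqs : Function.Surjective q := by
    rintro ⟨x, hx⟩
    obtain ⟨i, hi⟩ := Set.mem_iUnion.1 hx
    exact ⟨⟨i, τ i x⟩, Subtype.ext (hτ i x hi)⟩
  have hq : Topology.IsQuotientMap q := Topology.IsQuotientMap.of_surjective_continuous hqs q.continuous
  let Fm : C((_ : Fin n) × I, ℂ) := ⟨fun a => F a.1 a.2, continuous_sigma fun i => hFc i⟩
  have hfac : Function.FactorsThrough Fm q := by
    rintro ⟨i, s⟩ ⟨j, t⟩ h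
    exact hFall i j s t (congrArg Subtype.val h)
  refine hv0 (afb_eilenberg _ hA p hp hb hd v (hq.lift Fm hfac) ?_)
  intro z
  obtain ⟨⟨i, t⟩, rfl⟩ := hqs z
  have h1 : hq.lift Fm hfac (q ⟨i, t⟩) = F i t :=
    DFunLike.congr_fun (hq.lift_comp Fm hfac) ⟨i, t⟩
  rw [h1]
  simp only [F]
  rw [Complex.exp_sum]
  refine Finset.prod_congr rfl fun k _ => ?_
  rw [Complex.exp_int_mul, hf]
  rfl

/-- An `m`-intersecting family of `n ≥ 1` closed Jordan curves in general position cuts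
the plane into at most `m·n·(n-1)/2 + n + 1` connected components (faces). -/
theorem arrangement_face_bound (m n : ℕ) (hm : 1 ≤ m) (hn : 1 ≤ n)
    (γ : Fin n → Set Plane)
    (hinj : Function.Injective γ)
    (hcurve : ∀ i, IsJordanCurve (γ i))
    (hgp : GenPos γ)
    (hint : MIntersecting m γ) :
    {Δ : Set Plane | ∃ p ∈ (⋃ i, γ i)ᶜ, Δ = connectedComponentIn ((⋃ i, γ i)ᶜ) p}.Finite ∧
    ({Δ : Set Plane | ∃ p ∈ (⋃ i, γ i)ᶜ, Δ = connectedComponentIn ((⋃ i, γ i)ᶜ) p}.ncard : ℝ) ≤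
      (m : ℝ) * n * ((n : ℝ) - 1) / 2 + n + 1 := by
  set A := ⋃ i, γ i with hAdef
  have hA : IsCompact A := by
    refine isCompact_iUnion fun i => ?_
    obtain ⟨c, hc, -⟩ := afb_param (hcurve i)
    rw [← hc]
    exact isCompact_range c.continuous
  set S := {Δ : Set Plane | ∃ p ∈ Aᶜ, Δ = connectedComponentIn Aᶜ p} with hS
  let B := {Δ ∈ S | Bornology.IsBounded Δ}
  let T := {Δ ∈ S | ¬ Bornology.IsBounded Δ}
  have hT : T.encard ≤ 1 := by
    rw [Set.encard_le_one_iff]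
    rintro a b ⟨⟨x, -, rfl⟩, hx⟩ ⟨⟨y, -, rfl⟩, hy⟩
    exact afb_unbounded hA hx hy
  have hB : B.encard ≤ (n + n.choose 2 * m : ℕ) := by
    by_contra! hlt
    obtain ⟨t, htB, ht⟩ := Set.exists_subset_encard_eq
      (s := B) (k := ((n + n.choose 2 * m : ℕ) : ℕ∞) + 1) (Order.add_one_le_of_lt hlt)
    have htf : t.Finite := Set.finite_of_encard_eq_coe
      (k := n + n.choose 2 * m + 1) (by rw [ht]; norm_cast)
    have : Fintype t := htf.fintype
    choose p hpA hp using fun k : t => (htB k.2).1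
    have := afb_bounded_count m n γ hcurve hgp.1 hint hA p hpA
      (fun k => by rw [← hAdef, ← hp k]; exact (htB k.2).2)
      (fun k l h => by
        rw [← hAdef, ← hp k, ← hp l] at h; exact Subtype.ext h)
    have h2 : t.encard = Fintype.card t := by
      rw [Set.encard, ENat.card_eq_coe_fintype_card]
    rw [ht] at h2
    have h3 : n + n.choose 2 * m + 1 = Fintype.card t := by exact_mod_cast h2
    omega
  have hSBT : S ⊆ B ∪ T := fun Δ hΔ => by
    by_cases h : Bornology.IsBounded Δ
    · exact Or.inl ⟨hΔ, h⟩
    · exact Or.inr ⟨hΔ, h⟩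
  have hSe : S.encard ≤ ((n + n.choose 2 * m + 1 : ℕ) : ℕ∞) := by
    calc S.encard ≤ (B ∪ T).encard := Set.encard_le_encard hSBT
      _ ≤ B.encard + T.encard := Set.encard_union_le _ _
      _ ≤ (n + n.choose 2 * m : ℕ) + 1 := add_le_add hB hT
      _ = _ := by norm_cast
  obtain ⟨hfin, -⟩ := Set.encard_le_coe_iff.1 hSe
  refine ⟨hfin, ?_⟩
  have h4 : S.ncard ≤ n + n.choose 2 * m + 1 := by
    rw [← hfin.cast_ncard_eq] at hSe
    exact_mod_cast hSe
  have h5 : (S.ncard : ℝ) ≤ (n + n.choose 2 * m + 1 : ℕ) := by exact_mod_cast h4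
  refine h5.trans (le_of_eq ?_)
  push_cast
  rw [Nat.cast_choose_two]
  ring
end
end

section
/- There exists an absolute constant C > 0 with the following property. Let c > 0, let d ≥ 1, and let G be a finite simple graph on n vertices of maximum degree at most d such that every induced subgraph H of G on k vertices admits a separator of size at most c·√(k·d), i.e., a set S of at most c·√(k·d) vertices of H such that the vertices of H outside S can be partitioned into two sets with no edges of H between them, each of size at most 2k/3. Then for every real M with 1 ≤ M ≤ n there exists a set S* of vertices of G with |S*| ≤ C·c·n·√(d/M) such that every connected component of the induced subgraph of G on the complement of S* has fewer than M vertices. -/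
lemma sepdec_two (x y z m : ℝ) (hm : 0 < m) (hx : m ≤ x) (hy : 0 ≤ y) (hz : 0 ≤ z)
    (hy2 : y^2 ≤ 2 * x^2 / 3) (hz2 : z^2 ≤ 2 * x^2 / 3) (h : y^2 + z^2 ≤ x^2) :
    x + (18 * y^2 / m - 5 * y) + (18 * z^2 / m - 5 * z) ≤ 18 * x^2 / m - 5 * x := by
  have hx0 : 0 < x := by linarith
  have hy' : y ≤ 5 / 6 * x := by nlinarith
  have hz' : z ≤ 5 / 6 * x := by nlinarith
  have h1 : 18 * (x^2 - y^2 - z^2) / x ≤ 18 * (x^2 - y^2 - z^2) / m := by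
    apply div_le_div_of_nonneg_left _ hm hx
    linarith
  have h2 : 6 * x - 5 * (y + z) ≤ 18 * (x^2 - y^2 - z^2) / x := by
    rw [le_div_iff₀ hx0]
    nlinarith [mul_nonneg hy (sub_nonneg.2 hy'), mul_nonneg hz (sub_nonneg.2 hz')]
  have h3 : 18 * (x^2 - y^2 - z^2) / m = 18 * x^2 / m - 18 * y^2 / m - 18 * z^2 / m := by ring
  linarith

lemma sepdec_one (x y m : ℝ) (hm : 0 < m) (hx : m ≤ x) (hy : 0 ≤ y)
    (hy2 : y^2 ≤ 2 * x^2 / 3) :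
    x + (18 * y^2 / m - 5 * y) ≤ 18 * x^2 / m - 5 * x := by
  have hx0 : 0 < x := by linarith
  have h1 : 18 * (x^2 - y^2) / x ≤ 18 * (x^2 - y^2) / m := by
    apply div_le_div_of_nonneg_left _ hm hx
    nlinarith
  have h2 : 6 * x ≤ 18 * (x^2 - y^2) / x := by
    rw [le_div_iff₀ hx0]
    nlinarith
  have h3 : 18 * (x^2 - y^2) / m = 18 * x^2 / m - 18 * y^2 / m := by ring
  linarith

open Classical in
/-- The potential bounding the number of deleted vertices. -/
noncomputable def sepdecPot (M k : ℝ) : ℝ :=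
  if k < M then 0 else 18 * k / √M - 5 * √k

lemma sepdec_pot (M k a b : ℝ) (hM : 1 ≤ M) (hk : M ≤ k) (ha : 0 ≤ a) (hb : 0 ≤ b)
    (ha2 : a ≤ 2 * k / 3) (hb2 : b ≤ 2 * k / 3) (h : a + b ≤ k) :
    √k + sepdecPot M a + sepdecPot M b ≤ sepdecPot M k := by
  have hm : 0 < √M := Real.sqrt_pos.2 (by linarith)
  have hx := Real.sqrt_le_sqrt hk
  have ek := Real.sq_sqrt (show 0 ≤ k by linarith)
  have ea := Real.sq_sqrt ha
  have eb := Real.sq_sqrt hb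
  have h2 := sepdec_two (√k) (√a) (√b) (√M) hm hx (Real.sqrt_nonneg _) (Real.sqrt_nonneg _)
    (by rwa [ek, ea]) (by rwa [ek, eb]) (by rwa [ek, ea, eb])
  have h1a := sepdec_one (√k) (√a) (√M) hm hx (Real.sqrt_nonneg _) (by rwa [ek, ea])
  have h1b := sepdec_one (√k) (√b) (√M) hm hx (Real.sqrt_nonneg _) (by rwa [ek, eb])
  have h0 := sepdec_one (√k) 0 (√M) hm hx le_rfl (by rw [ek]; norm_num; linarith)
  rw [ek] at *
  rw [ea] at h2 h1a
  rw [eb] at h2 h1b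
  unfold sepdecPot
  rw [if_neg (not_lt.2 hk)]
  norm_num at h0
  split_ifs <;> linarith

/-- Cut form of connectedness of a vertex set. -/
def SepdecConn {V : Type} (G : SimpleGraph V) (T : Set V) : Prop :=
  ∀ A B : Set V, T ⊆ A ∪ B → (∀ a ∈ A, ∀ b ∈ B, ¬G.Adj a b) → T ⊆ A ∨ T ⊆ B

lemma sepdec_comp {V : Type} (G : SimpleGraph V) (U : Set V)
    (K : (G.induce U).ConnectedComponent) : SepdecConn G (Subtype.val '' K.supp) := by
  intro A B hT hAB
  by_contra hcon
  push Not at hcon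
  obtain ⟨h1, h2⟩ := hcon
  rw [Set.not_subset] at h1 h2
  obtain ⟨_, ⟨x, hxK, rfl⟩, hx⟩ := h1
  obtain ⟨_, ⟨y, hyK, rfl⟩, hy⟩ := h2
  have hyA : y.1 ∈ A := (hT ⟨y, hyK, rfl⟩).resolve_right hy
  have hr : (G.induce U).Reachable y x := by
    rw [SimpleGraph.ConnectedComponent.mem_supp_iff] at hxK hyK
    exact SimpleGraph.ConnectedComponent.eq.1 (hyK.trans hxK.symm)
  obtain ⟨p⟩ := hr
  obtain ⟨e, -, he1, he2⟩ := p.exists_boundary_dart {v | v ∈ K.supp ∧ v.1 ∈ A}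
    ⟨hyK, hyA⟩ (fun h => hx h.2)
  have hadj := e.adj
  have hsK : e.snd ∈ K.supp := by
    have := he1.1
    rw [SimpleGraph.ConnectedComponent.mem_supp_iff] at this ⊢
    rw [← this]
    exact SimpleGraph.ConnectedComponent.eq.2 hadj.symm.reachable
  have hsA : e.snd.1 ∉ A := fun h => he2 ⟨hsK, h⟩
  have hsB : e.snd.1 ∈ B := (hT ⟨_, hsK, rfl⟩).resolve_left hsA
  exact hAB _ he1.2 _ hsB hadj

lemma sepdec_rec (s M : ℝ) (hs : 0 ≤ s) (hM : 1 ≤ M) (V : Type) [Fintype V] (G : SimpleGraph V)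
    (hsep : ∀ W : Set V, ∃ S A B : Set V,
            S ∪ A ∪ B = W ∧
            Disjoint A B ∧
            (∀ a ∈ A, ∀ b ∈ B, ¬G.Adj a b) ∧
            (A.ncard : ℝ) ≤ 2 * (W.ncard : ℝ) / 3 ∧
            (B.ncard : ℝ) ≤ 2 * (W.ncard : ℝ) / 3 ∧
            (S.ncard : ℝ) ≤ s * √(W.ncard : ℝ)) (n : ℕ) :
    ∀ W : Set V, W.ncard = n → ∃ X : Set V, (X.ncard : ℝ) ≤ s * sepdecPot M W.ncard ∧
      ∀ T ⊆ W, Disjoint T X → SepdecConn G T → (T.ncard : ℝ) < M := by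
  induction n using Nat.strong_induction_on with
  | _ n ih =>
  intro W hW
  by_cases hk : (W.ncard : ℝ) < M
  · refine ⟨∅, by simp [sepdecPot, hk], fun T hT _ _ => lt_of_le_of_lt ?_ hk⟩
    exact_mod_cast Set.ncard_le_ncard hT
  have hk' := not_lt.1 hk
  obtain ⟨S, A, B, hU, hd, hAB, hA, hB, hS⟩ := hsep W
  have hAn : A.ncard < n := by
    have : (A.ncard : ℝ) < W.ncard := by linarith
    rw [← hW]; exact_mod_cast this
  have hBn : B.ncard < n := by
    have : (B.ncard : ℝ) < W.ncard := by linarith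
    rw [← hW]; exact_mod_cast this
  obtain ⟨X, hX, hX'⟩ := ih _ hAn A rfl
  obtain ⟨Y, hY, hY'⟩ := ih _ hBn B rfl
  have hsum : (A.ncard : ℝ) + B.ncard ≤ W.ncard := by
    have h1 := Set.ncard_union_eq hd
    have h2 : (A ∪ B).ncard ≤ W.ncard := by
      refine Set.ncard_le_ncard ?_ (Set.toFinite _)
      rw [← hU, Set.union_assoc]
      exact Set.subset_union_right
    rw [h1] at h2
    exact_mod_cast h2
  have hp := sepdec_pot M W.ncard A.ncard B.ncard hM hk' (Nat.cast_nonneg _) (Nat.cast_nonneg _)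
    hA hB hsum
  refine ⟨S ∪ X ∪ Y, ?_, ?_⟩
  · have h1 : ((S ∪ X ∪ Y).ncard : ℝ) ≤ S.ncard + X.ncard + Y.ncard := by
      have h2 := Set.ncard_union_le (S ∪ X) Y
      have h3 := Set.ncard_union_le S X
      exact_mod_cast h2.trans (Nat.add_le_add_right h3 _)
    have := mul_le_mul_of_nonneg_left hp hs
    linarith
  · intro T hT hTd hc
    rw [Set.disjoint_union_right, Set.disjoint_union_right] at hTd
    have hTU : T ⊆ A ∪ B := by
      intro v hv
      have := hT hv
      rw [← hU] at this
      rcases this with (h | h) | h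
      · exact absurd h (Set.disjoint_left.1 hTd.1.1 hv)
      · exact Or.inl h
      · exact Or.inr h
    rcases hc A B hTU hAB with h | h
    · exact hX' T h hTd.1.2 hc
    · exact hY' T h hTd.2 hc


/-- Recursive separator decomposition: if every induced subgraph of a bounded-degree
graph `G` admits a `c·√(kd)`-size separator, then for any `1 ≤ M ≤ n` one can delete
`O(c·n·√(d/M))` vertices so that all remaining connected components have fewer than `M`
vertices. -/
theorem separator_decomposition :
    ∃ C : ℝ, 0 < C ∧
      ∀ (c : ℝ), 0 < c →
      ∀ (d : ℕ), 1 ≤ d →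
      ∀ (V : Type) [Fintype V] (G : SimpleGraph V),
        (∀ v : V, (G.neighborSet v).ncard ≤ d) →
        (∀ W : Set V, ∃ S A B : Set V,
            S ∪ A ∪ B = W ∧
            Disjoint S A ∧ Disjoint S B ∧ Disjoint A B ∧
            (∀ a ∈ A, ∀ b ∈ B, ¬G.Adj a b) ∧
            (A.ncard : ℝ) ≤ 2 * (W.ncard : ℝ) / 3 ∧
            (B.ncard : ℝ) ≤ 2 * (W.ncard : ℝ) / 3 ∧
            (S.ncard : ℝ) ≤ c * Real.sqrt ((W.ncard : ℝ) * d)) →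
        ∀ M : ℝ, 1 ≤ M → M ≤ (Fintype.card V : ℝ) →
          ∃ Sstar : Set V,
            (Sstar.ncard : ℝ) ≤ C * c * (Fintype.card V : ℝ) * Real.sqrt ((d : ℝ) / M) ∧
            ∀ K : (G.induce (Sstarᶜ)).ConnectedComponent, (K.supp.ncard : ℝ) < M := by
  refine ⟨18, by norm_num, ?_⟩
  intro c hc d hd V _ G _ hsep M hM hMn
  obtain ⟨X, hX, hX'⟩ := sepdec_rec (c * √(d : ℝ)) M (by positivity) hM V G (by
    intro W
    obtain ⟨S, A, B, h1, _, _, h2, h3, h4, h5, h6⟩ := hsep W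
    refine ⟨S, A, B, h1, h2, h3, h4, h5, h6.trans (le_of_eq ?_)⟩
    rw [Real.sqrt_mul (Nat.cast_nonneg _)]
    ring) _ Set.univ rfl
  refine ⟨X, hX.trans ?_, ?_⟩
  · rw [Set.ncard_univ, Nat.card_eq_fintype_card]
    unfold sepdecPot
    rw [if_neg (not_lt.2 hMn), Real.sqrt_div (Nat.cast_nonneg _)]
    have h : 0 ≤ c * √(d : ℝ) * (5 * √(Fintype.card V : ℝ)) := by positivity
    have e : 18 * c * (Fintype.card V : ℝ) * (√(d : ℝ) / √M)
        = c * √(d : ℝ) * (18 * (Fintype.card V : ℝ) / √M) := by ring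
    rw [e, mul_sub]
    linarith
  · intro K
    have := hX' (Subtype.val '' K.supp) (Set.subset_univ _) (by
      rw [Set.disjoint_left]
      rintro _ ⟨x, _, rfl⟩
      exact x.2) (sepdec_comp G _ K)
    rwa [Set.ncard_image_of_injective _ Subtype.val_injective] at this
end

section
/- There exist constants c > 0 and C > 0 such that for every sufficiently large n there exists a family of n closed Jordan curves in general position in the plane that has at least c·n² touching pairs while determining at most C·n²·log n intersection points. -/
noncomputable section

inductive Pth {α : Type*} : List α → List α → List (Sym2 α) → Prop
  | nil (l : List α) : Pth l l []
  | swap (A : List α) (x y : α) (B : List α) : Pth (A ++ x :: y :: B) (A ++ y :: x :: B) [s(x, y)]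
  | touch (A : List α) (x y : α) (B : List α) : Pth (A ++ x :: y :: B) (A ++ x :: y :: B) [s(x, y)]
  | trans {l l' lc : List α} {E E' : List (Sym2 α)} :
      Pth l l' E → Pth l' lc E' → Pth l lc (E ++ E')

namespace Pth
variable {α : Type*}

theorem ctx {l l' : List α} {E : List (Sym2 α)} (h : Pth l l' E) (P S : List α) :
    Pth (P ++ l ++ S) (P ++ l' ++ S) E := by
  induction h with
  | nil l => exact Pth.nil _
  | swap A x y B => simpa using Pth.swap (P ++ A) x y (B ++ S)
  | touch A x y B => simpa using Pth.touch (P ++ A) x y (B ++ S)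
  | trans _ _ h1 h2 => exact h1.trans h2

theorem perm {l l' : List α} {E : List (Sym2 α)} (h : Pth l l' E) : l.Perm l' := by
  induction h with
  | nil l => exact List.Perm.refl _
  | swap A x y B => exact (List.Perm.swap y x B).append_left A
  | touch A x y B => exact List.Perm.refl _
  | trans _ _ h1 h2 => exact h1.trans h2

theorem move (a : α) (B : List α) : ∃ E, Pth (a :: B) (B ++ [a]) E ∧ E.length = B.length ∧
    ∀ e ∈ E, ∀ v ∈ e, v ∈ a :: B := by
  induction B with
  | nil => exact ⟨[], Pth.nil _, rfl, by simp⟩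
  | cons b B ih =>
    obtain ⟨E, h, hl, hm⟩ := ih
    refine ⟨[s(a, b)] ++ E, (Pth.swap [] a b B).trans ?_, by simp [hl], ?_⟩
    · simpa using h.ctx [b] []
    · intro e he v hv
      rcases List.mem_append.1 he with he | he
      · rw [List.mem_singleton.1 he, Sym2.mem_iff] at hv
        rcases hv with rfl | rfl <;> simp
      · have := hm e he v hv
        simp at this ⊢
        tauto

theorem block (A B : List α) : ∃ E, Pth (A ++ B) (B ++ A) E ∧ E.length = A.length * B.length ∧
    ∀ e ∈ E, ∀ v ∈ e, v ∈ A ++ B := by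
  induction A with
  | nil => exact ⟨[], by simpa using Pth.nil B, by simp, by simp⟩
  | cons a A ih =>
    obtain ⟨E, h, hl, hm⟩ := ih
    obtain ⟨E', h', hl', hm'⟩ := move a B
    refine ⟨E ++ E', ?_, by simp [hl, hl']; ring, ?_⟩
    · have h1 := h.ctx [a] []
      have h2 := h'.ctx [] A
      simp at h1 h2
      exact h1.trans h2
    · intro e he v hv
      rcases List.mem_append.1 he with he | he
      · have := hm e he v hv
        simp at this ⊢
        tauto
      · have := hm' e he v hv
        simp at this ⊢
        tauto

set_option maxHeartbeats 4000000 in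
theorem main [DecidableEq α] (k : ℕ) : ∀ G F : List α, G.length = 2 ^ k → F.length = 2 ^ k →
    (G ++ F).Nodup → ∃ E, Pth (G ++ F) (G ++ F) E ∧ E.length = (k + 1) * 4 ^ k ∧
      (∀ g ∈ G, ∀ f ∈ F, E.count s(g, f) = 1) ∧ ∀ e ∈ E, ∀ v ∈ e, v ∈ G ++ F := by
  induction k with
  | zero =>
    intro G F hG hF hn
    obtain ⟨g, rfl⟩ := List.length_eq_one_iff.1 (by simpa using hG)
    obtain ⟨f, rfl⟩ := List.length_eq_one_iff.1 (by simpa using hF)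
    refine ⟨[s(g, f)], Pth.touch [] g f [], by simp, by simp, ?_⟩
    intro e he v hv
    rw [List.mem_singleton.1 he, Sym2.mem_iff] at hv
    rcases hv with rfl | rfl <;> simp
  | succ k ih =>
    intro G F hG hF hn
    obtain ⟨G1, G2, rfl, hG1, hG2⟩ : ∃ G1 G2, G = G1 ++ G2 ∧ G1.length = 2 ^ k ∧
        G2.length = 2 ^ k :=
      ⟨G.take (2 ^ k), G.drop (2 ^ k), by simp, by simp [hG, pow_succ], by
        simp [hG, pow_succ]; omega⟩
    obtain ⟨F1, F2, rfl, hF1, hF2⟩ : ∃ G1 G2, F = G1 ++ G2 ∧ G1.length = 2 ^ k ∧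
        G2.length = 2 ^ k :=
      ⟨F.take (2 ^ k), F.drop (2 ^ k), by simp, by simp [hF, pow_succ], by
        simp [hF, pow_succ]; omega⟩
    clear hG hF
    obtain ⟨E1, p1, l1, c1, m1⟩ := ih G2 F1 hG2 hF1 (by
      simp only [List.nodup_append, List.mem_append] at hn ⊢; grind)
    obtain ⟨E2, p2, l2, c2, m2⟩ := ih G2 F2 hG2 hF2 (by
      simp only [List.nodup_append, List.mem_append] at hn ⊢; grind)
    obtain ⟨E3, p3, l3, c3, m3⟩ := ih G1 F2 hG1 hF2 (by
      simp only [List.nodup_append, List.mem_append] at hn ⊢; grind)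
    obtain ⟨E4, p4, l4, c4, m4⟩ := ih G1 F1 hG1 hF1 (by
      simp only [List.nodup_append, List.mem_append] at hn ⊢; grind)
    obtain ⟨S1, q1, r1, s1⟩ := block F1 F2
    obtain ⟨S2, q2, r2, s2⟩ := block G1 G2
    obtain ⟨S3, q3, r3, s3⟩ := block F2 F1
    obtain ⟨S4, q4, r4, s4⟩ := block G2 G1
    have P1 := p1.ctx G1 F2
    have Q1 := q1.ctx (G1 ++ G2) []
    have P2 := p2.ctx G1 F1
    have Q2 := q2.ctx [] (F2 ++ F1)
    have P3 := p3.ctx G2 F1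
    have Q3 := q3.ctx (G2 ++ G1) []
    have P4 := p4.ctx G2 F2
    have Q4 := q4.ctx [] (F1 ++ F2)
    simp only [List.append_assoc, List.nil_append, List.append_nil] at P1 Q1 P2 Q2 P3 Q3 P4 Q4
    refine ⟨E1 ++ (S1 ++ (E2 ++ (S2 ++ (E3 ++ (S3 ++ (E4 ++ S4)))))), ?_, ?_, ?_, ?_⟩
    · simp only [List.append_assoc]
      exact P1.trans (Q1.trans (P2.trans (Q2.trans (P3.trans (Q3.trans (P4.trans Q4))))))
    · simp only [List.length_append, l1, l2, l3, l4, r1, r2, r3, r4, hG1, hG2, hF1, hF2]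
      have : (2 : ℕ) ^ k * 2 ^ k = 4 ^ k := by rw [← mul_pow]; norm_num
      rw [this, pow_succ]; ring
    · intro g hg f hf
      have z : ∀ (E : List (Sym2 α)) (L : List α), (∀ e ∈ E, ∀ v ∈ e, v ∈ L) →
          (g ∉ L ∨ f ∉ L) → E.count s(g, f) = 0 := by
        intro E L h1 h2
        refine List.count_eq_zero.2 fun h => ?_
        have a := h1 _ h g (by simp)
        have b := h1 _ h f (by simp)
        tauto
      simp only [List.count_append]
      have hd : ∀ a ∈ G1, a ∉ G2 ∧ a ∉ F1 ∧ a ∉ F2 := by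
        simp only [List.nodup_append, List.mem_append] at hn; grind
      have hd2 : ∀ a ∈ G2, a ∉ F1 ∧ a ∉ F2 := by
        simp only [List.nodup_append, List.mem_append] at hn; grind
      have hd3 : ∀ a ∈ F1, a ∉ F2 := by
        simp only [List.nodup_append, List.mem_append] at hn; grind
      rw [z S1 _ s1 (by grind), z S2 _ s2 (by grind), z S3 _ s3 (by grind), z S4 _ s4 (by grind)]
      rcases List.mem_append.1 hg with hg | hg <;> rcases List.mem_append.1 hf with hf | hf
      · rw [z E1 _ m1 (by grind), z E2 _ m2 (by grind), z E3 _ m3 (by grind), c4 g hg f hf]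
      · rw [z E1 _ m1 (by grind), z E2 _ m2 (by grind), c3 g hg f hf, z E4 _ m4 (by grind)]
      · rw [c1 g hg f hf, z E2 _ m2 (by grind), z E3 _ m3 (by grind), z E4 _ m4 (by grind)]
      · rw [z E1 _ m1 (by grind), c2 g hg f hf, z E3 _ m3 (by grind), z E4 _ m4 (by grind)]
    · intro e he v hv
      simp only [List.mem_append] at he ⊢
      rcases he with h | h | h | h | h | h | h | h
      · have := m1 e h v hv; simp at this; tauto
      · have := s1 e h v hv; simp at this; tauto
      · have := m2 e h v hv; simp at this; tauto
      · have := s2 e h v hv; simp at this; tauto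
      · have := m3 e h v hv; simp at this; tauto
      · have := s3 e h v hv; simp at this; tauto
      · have := m4 e h v hv; simp at this; tauto
      · have := s4 e h v hv; simp at this; tauto

end Pth

/-- One elementary step, realised by a continuous motion. -/
theorem step_realize {n : ℕ} (A : List (Fin n)) (x y : Fin n) (B : List (Fin n))
    (hn : (A ++ x :: y :: B).Nodup) (hc : ∀ i, i ∈ A ++ x :: y :: B)
    (φ : ℝ → ℝ) (hφ : Continuous φ) (h0 : φ 0 = 0)
    (hb : ∀ t, 0 ≤ t → t ≤ 1 → 0 ≤ φ t ∧ φ t ≤ 1)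
    (hh : ∀ t, 0 ≤ t → t ≤ 1 → (φ t = 1 / 2 ↔ t = 1 / 2)) :
    ∃ f : ℝ → Fin n → ℝ, Continuous f ∧ (∀ i, f 0 i = ((A ++ x :: y :: B).idxOf i : ℕ)) ∧
      (∀ i, f 1 i = if i = x then A.length + φ 1 else if i = y then A.length + 1 - φ 1
        else ((A ++ x :: y :: B).idxOf i : ℕ)) ∧
      ∀ t : ℝ, 0 ≤ t → t ≤ 1 → ∀ i k, i ≠ k →
        (f t i = f t k ↔ ∃ m : ℕ, t = m + 1 / 2 ∧ [s(x, y)][m]? = some s(i, k)) := by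
  have hxA : x ∉ A := by simp only [List.nodup_append, List.mem_cons] at hn; grind
  have hyA : y ∉ A := by simp only [List.nodup_append, List.mem_cons] at hn; grind
  have hxy : x ≠ y := by simp only [List.nodup_append, List.nodup_cons, List.mem_cons] at hn; grind
  have ix : (A ++ x :: y :: B).idxOf x = A.length := by
    rw [List.idxOf_append, if_neg hxA]; simp
  have iy : (A ++ x :: y :: B).idxOf y = A.length + 1 := by
    rw [List.idxOf_append, if_neg hyA, List.idxOf_cons_ne _ hxy]; simp [add_comm]
  have inj : ∀ i k, i ≠ k → (A ++ x :: y :: B).idxOf i ≠ (A ++ x :: y :: B).idxOf k :=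
    fun i k hik h => hik ((List.idxOf_inj (hc i)).1 h)
  generalize (A ++ x :: y :: B) = l at *
  generalize A.length = p at *
  have key : ∀ t : ℝ, (∀ i k : Fin n, (∃ m : ℕ, t = m + 1 / 2 ∧ [s(x, y)][m]? = some s(i, k)) ↔
      t = 1 / 2 ∧ s(x, y) = s(i, k)) := by
    intro t i k
    constructor
    · rintro ⟨m, hm, h⟩
      rcases m with _ | m
      · simp at hm h
        exact ⟨by simp [hm], by simpa using h⟩
      · simp at h
    · rintro ⟨h, h'⟩
      exact ⟨0, by simp [h], by simp [h']⟩
  have far : ∀ i, i ≠ x → i ≠ y → ∀ r : ℝ, 0 ≤ r → r ≤ 1 → (p : ℝ) + r ≠ (l.idxOf i : ℕ) := by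
    intro i hx hy r h0 h1 he
    have a := inj i x hx
    have b := inj i y hy
    rw [ix] at a
    rw [iy] at b
    have c1 : (p : ℝ) ≤ (l.idxOf i : ℕ) := by linarith
    have c2 : ((l.idxOf i : ℕ) : ℝ) ≤ ((p + 1 : ℕ) : ℝ) := by push_cast; linarith
    have c1 := Nat.cast_le.1 c1
    have c2 := Nat.cast_le.1 c2
    omega
  refine ⟨fun t i => if i = x then p + φ t else if i = y then p + 1 - φ t else (l.idxOf i : ℕ),
    ?_, ?_, ?_, ?_⟩
  · refine continuous_pi fun i => ?_
    split_ifs <;> fun_prop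
  · intro i
    dsimp only
    split_ifs with h1 h2
    · rw [h1, ix, h0]; simp
    · rw [h2, iy, h0]; simp
    · rfl
  · intro i; rfl
  · intro t t0 t1 i k hik
    rw [key, ← hh t t0 t1]
    obtain ⟨b0, b1⟩ := hb t t0 t1
    dsimp only
    by_cases i1 : i = x
    · rw [if_pos i1]
      by_cases k1 : k = x
      · exact absurd (i1.trans k1.symm) hik
      rw [if_neg k1]
      by_cases k2 : k = y
      · rw [if_pos k2, i1, k2]
        constructor
        · intro h; exact ⟨by linarith, rfl⟩
        · rintro ⟨h, -⟩; linarith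
      · rw [if_neg k2]
        constructor
        · intro h; exact absurd h (far k k1 k2 _ b0 b1)
        · rintro ⟨-, h⟩; rw [Sym2.eq_iff] at h; grind
    rw [if_neg i1]
    by_cases i2 : i = y
    · rw [if_pos i2]
      by_cases k1 : k = x
      · rw [if_pos k1, i2, k1]
        constructor
        · intro h; exact ⟨by linarith, Sym2.eq_swap⟩
        · rintro ⟨h, -⟩; linarith
      rw [if_neg k1]
      by_cases k2 : k = y
      · exact absurd (i2.trans k2.symm) hik
      · rw [if_neg k2]
        constructor
        · intro h
          exact absurd (by linarith : (p : ℝ) + (1 - φ t) = _) (far k k1 k2 _ (by linarith) (by linarith))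
        · rintro ⟨-, h⟩; rw [Sym2.eq_iff] at h; grind
    rw [if_neg i2]
    constructor
    · intro h
      exfalso
      by_cases k1 : k = x
      · rw [if_pos k1] at h
        exact far i i1 i2 _ b0 b1 h.symm
      rw [if_neg k1] at h
      by_cases k2 : k = y
      · rw [if_pos k2] at h
        exact far i i1 i2 (1 - φ t) (by linarith) (by linarith) (by linarith)
      · rw [if_neg k2] at h
        exact inj i k hik (by exact_mod_cast h)
    · rintro ⟨-, h⟩; rw [Sym2.eq_iff] at h; grind

theorem Pth.realize {n : ℕ} {l l' : List (Fin n)} {E : List (Sym2 (Fin n))} (h : Pth l l' E)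
    (hn : l.Nodup) (hc : ∀ i, i ∈ l) :
    ∃ f : ℝ → Fin n → ℝ, Continuous f ∧ (∀ i, f 0 i = (l.idxOf i : ℕ)) ∧
      (∀ i, f E.length i = (l'.idxOf i : ℕ)) ∧
      ∀ t : ℝ, 0 ≤ t → t ≤ E.length → ∀ i k, i ≠ k →
        (f t i = f t k ↔ ∃ m : ℕ, t = m + 1 / 2 ∧ E[m]? = some s(i, k)) := by
  induction h with
  | nil l =>
    refine ⟨fun _ i => (l.idxOf i : ℕ), by fun_prop, fun _ => rfl, fun _ => rfl, ?_⟩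
    intro t _ _ i k hik
    simp only [List.getElem?_nil, reduceCtorEq, and_false, exists_false, iff_false]
    intro h
    exact hik ((List.idxOf_inj (hc i)).1 (by exact_mod_cast h))
  | swap A x y B =>
    obtain ⟨f, f1, f2, f3, f4⟩ := step_realize A x y B hn hc (fun t => t) continuous_id rfl
      (fun t h h' => ⟨h, h'⟩) (fun t _ _ => Iff.rfl)
    have hxA : x ∉ A := by simp only [List.nodup_append, List.mem_cons] at hn; grind
    have hyA : y ∉ A := by simp only [List.nodup_append, List.mem_cons] at hn; grind
    have hxy : x ≠ y := by
      simp only [List.nodup_append, List.nodup_cons, List.mem_cons] at hn; grind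
    refine ⟨f, f1, f2, ?_, by simpa using f4⟩
    intro i
    simp only [List.length_singleton, Nat.cast_one]
    rw [f3]
    split_ifs with h1 h2
    · rw [h1, List.idxOf_append, if_neg hxA, List.idxOf_cons_ne _ hxy.symm]; simp [add_comm]
    · rw [h2, List.idxOf_append, if_neg hyA]; simp
    · simp only [List.idxOf_append, List.idxOf_cons_ne _ (Ne.symm h1),
        List.idxOf_cons_ne _ (Ne.symm h2)]
  | touch A x y B =>
    obtain ⟨f, f1, f2, f3, f4⟩ := step_realize A x y B hn hc (fun t => min t (1 - t))
      (by fun_prop) (by simp)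
      (fun t h h' => ⟨le_min h (by linarith), (min_le_left _ _).trans h'⟩) (fun t _ _ => by
        rcases le_total t (1 - t) with h | h
        · rw [min_eq_left h]
        · rw [min_eq_right h]; constructor <;> intro _ <;> linarith)
    have hxA : x ∉ A := by simp only [List.nodup_append, List.mem_cons] at hn; grind
    have hyA : y ∉ A := by simp only [List.nodup_append, List.mem_cons] at hn; grind
    have hxy : x ≠ y := by
      simp only [List.nodup_append, List.nodup_cons, List.mem_cons] at hn; grind
    refine ⟨f, f1, f2, ?_, by simpa using f4⟩
    intro i
    simp only [List.length_singleton, Nat.cast_one]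
    rw [f3]
    split_ifs with h1 h2
    · rw [h1, List.idxOf_append, if_neg hxA]; simp
    · rw [h2, List.idxOf_append, if_neg hyA, List.idxOf_cons_ne _ hxy]; simp [add_comm]
    · rfl
  | @trans l l' lc E E' p1 p2 ih1 ih2 =>
    obtain ⟨f, f1, f2, f3, f4⟩ := ih1 hn hc
    obtain ⟨g, g1, g2, g3, g4⟩ := ih2 (p1.perm.nodup_iff.1 hn) (fun i => p1.perm.mem_iff.1 (hc i))
    refine ⟨fun t => if t ≤ E.length then f t else g (t - E.length), ?_, ?_, ?_, ?_⟩
    · refine Continuous.if_le f1 (by fun_prop) continuous_id continuous_const ?_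
      intro t ht
      change t = _ at ht
      rw [ht]
      ext i
      rw [f3, sub_self, g2]
    · intro i
      dsimp only
      rw [if_pos (by positivity), f2]
    · intro i
      dsimp only
      split_ifs with h
      · have : E'.length = 0 := by
          simp only [List.length_append] at h
          have := Nat.cast_le.1 h
          omega
        rw [this, Nat.cast_zero] at g3
        simp only [List.length_append, this, add_zero]
        rw [f3, ← g2, g3]
      · simp only [List.length_append, Nat.cast_add, add_sub_cancel_left]
        exact g3 i
    · intro t t0 t1 i k hik
      simp only [List.length_append, Nat.cast_add] at t1
      dsimp only
      split_ifs with h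
      · rw [f4 t t0 h i k hik]
        refine exists_congr fun m => and_congr_right fun hm => ?_
        have : m < E.length := by
          have : (m : ℝ) < E.length := by linarith
          exact_mod_cast this
        rw [List.getElem?_append_left this]
      · push Not at h
        rw [g4 _ (by linarith) (by linarith) i k hik]
        constructor
        · rintro ⟨m, hm, he⟩
          refine ⟨m + E.length, by push_cast; linarith, ?_⟩
          rw [List.getElem?_append_right (by omega), Nat.add_sub_cancel]
          exact he
        · rintro ⟨m, hm, he⟩
          have hl : E.length ≤ m := by
            by_contra hlt
            have : ((m + 1 : ℕ) : ℝ) ≤ E.length := Nat.cast_le.2 (by omega)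
            push_cast at this
            linarith
          refine ⟨m - E.length, by rw [Nat.cast_sub hl]; linarith, ?_⟩
          rwa [List.getElem?_append_right hl] at he

def toPlane : ℂ ≃ₗᵢ[ℝ] Plane := Complex.orthonormalBasisOneI.repr

def polar {T : ℝ} (F : AddCircle T → ℝ) (θ : AddCircle T) : Plane :=
  toPlane ((Real.exp (F θ) : ℂ) * (AddCircle.toCircle θ : ℂ))

theorem polar_eq {T : ℝ} (hT : T ≠ 0) (F G : AddCircle T → ℝ) (θ θ' : AddCircle T)
    (h : polar F θ = polar G θ') : θ = θ' ∧ F θ = G θ' := by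
  have h := toPlane.injective h
  have h1 := congrArg norm h
  simp only [norm_mul, Complex.norm_real, Circle.norm_coe, mul_one, Real.norm_eq_abs,
    Real.abs_exp] at h1
  rw [h1] at h
  refine ⟨?_, Real.exp_injective h1⟩
  have h2 := mul_left_cancel₀ (by exact_mod_cast (Real.exp_pos _).ne') h
  exact AddCircle.injective_toCircle hT (Circle.coe_injective h2)

theorem polar_jordan {T : ℝ} [hp : Fact (0 < T)] (F : AddCircle T → ℝ) (hF : Continuous F) :
    IsJordanCurve (Set.range (polar F)) := by
  have hT : T ≠ 0 := hp.out.ne'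
  have hc : Continuous (polar F) := by
    unfold polar
    refine toPlane.continuous.comp ?_
    refine Continuous.mul (by fun_prop) ?_
    have h1 : Continuous (AddCircle.toCircle : AddCircle T → Circle) := by
      have h := (AddCircle.homeomorphCircle hT).continuous
      have e : ⇑(AddCircle.homeomorphCircle hT) = AddCircle.toCircle :=
        funext (AddCircle.homeomorphCircle_apply hT)
      rwa [e] at h
    exact continuous_subtype_val.comp h1
  have hi : Function.Injective (polar F) := fun a b h => (polar_eq hT F F a b h).1
  have e1 := (hc.isClosedEmbedding hi).isEmbedding.toHomeomorph
  have e2 : Circle ≃ₜ Metric.sphere (0 : Plane) 1 :=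
    Homeomorph.subtype (p := fun z : ℂ => z ∈ Submonoid.unitSphere ℂ)
      (q := fun z => z ∈ Metric.sphere (0 : Plane) 1) toPlane.toHomeomorph
      (fun z => by simp [Submonoid.unitSphere])
  exact ⟨e1.symm.trans ((AddCircle.homeomorphCircle hT).trans e2)⟩

/-- A closed sequence of moves yields a family of closed Jordan curves. -/
theorem Pth.family {n : ℕ} {l : List (Fin n)} {E : List (Sym2 (Fin n))} (h : Pth l l E)
    (hn : l.Nodup) (hc : ∀ i, i ∈ l) (hE : 0 < E.length) :
    ∃ γ : Fin n → Set Plane, Function.Injective γ ∧ (∀ i, IsJordanCurve (γ i)) ∧ GenPos γ ∧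
      (interPoints γ).Finite ∧ (interPoints γ).ncard ≤ E.length ∧
      ∀ i k, i ≠ k → E.count s(i, k) = 1 → Touches (γ i) (γ k) := by
  obtain ⟨f, f1, f2, f3, f4⟩ := h.realize hn hc
  set T : ℝ := (E.length : ℝ) with hTdef
  have hT : 0 < T := by rw [hTdef]; exact_mod_cast hE
  have : Fact (0 < T) := ⟨hT⟩
  have hlt : ∀ m, m < E.length → ((m : ℝ) + 1 / 2) ∈ Set.Ico 0 T := by
    intro m hm
    have : ((m + 1 : ℕ) : ℝ) ≤ T := Nat.cast_le.2 hm
    push_cast at this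
    constructor
    · positivity
    · linarith
  let F : Fin n → AddCircle T → ℝ := fun i => AddCircle.liftIco T 0 (fun t => f t i)
  have hF : ∀ i t, t ∈ Set.Ico 0 T → F i (t : AddCircle T) = f t i :=
    fun i t ht => AddCircle.liftIco_zero_coe_apply ht
  have hFc : ∀ i, Continuous (F i) := fun i =>
    AddCircle.liftIco_zero_continuous (by rw [f2, f3])
      ((continuous_apply i).comp f1).continuousOn
  -- coincidences
  have key : ∀ i k, i ≠ k → ∀ p, p ∈ Set.range (polar (F i)) → p ∈ Set.range (polar (F k)) →
      ∃ m : ℕ, m < E.length ∧ E[m]? = some s(i, k) ∧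
        p = polar (F i) (((m : ℝ) + 1 / 2 : ℝ) : AddCircle T) := by
    rintro i k hik p ⟨θ, rfl⟩ ⟨θ', h'⟩
    obtain ⟨rfl, h2⟩ := polar_eq hT.ne' _ _ _ _ h'
    obtain ⟨t, ht, rfl⟩ : ∃ t ∈ Set.Ico 0 T, (t : AddCircle T) = θ' := by
      have := (AddCircle.equivIco T 0 θ').2
      exact ⟨_, ⟨this.1, by simpa only [zero_add] using this.2⟩, AddCircle.coe_equivIco⟩
    rw [hF _ _ ht, hF _ _ ht] at h2
    obtain ⟨m, hm, he⟩ := (f4 t ht.1 ht.2.le i k hik).1 h2.symm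
    exact ⟨m, (List.getElem?_eq_some_iff.1 he).1, he, by rw [hm]⟩
  have key2 : ∀ (m : ℕ) (i k : Fin n), i ≠ k → E[m]? = some s(i, k) →
      polar (F i) (((m : ℝ) + 1 / 2 : ℝ) : AddCircle T) =
      polar (F k) (((m : ℝ) + 1 / 2 : ℝ) : AddCircle T) := by
    intro m i k hik he
    have hm := hlt m (List.getElem?_eq_some_iff.1 he).1
    unfold polar
    rw [hF _ _ hm, hF _ _ hm, (f4 _ hm.1 hm.2.le i k hik).2 ⟨m, rfl, he⟩]
  have meq : ∀ m m' : ℕ, m < E.length → m' < E.length → ∀ i k,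
      polar (F i) (((m : ℝ) + 1 / 2 : ℝ) : AddCircle T) =
      polar (F k) (((m' : ℝ) + 1 / 2 : ℝ) : AddCircle T) → m = m' := by
    intro m m' hm hm' i k he
    have h1 := (polar_eq hT.ne' _ _ _ _ he).1
    have a1 := hlt m hm
    have a2 := hlt m' hm'
    have h2 := (AddCircle.coe_eq_coe_iff_of_mem_Ico (a := 0) ⟨a1.1, by linarith [a1.2]⟩
      ⟨a2.1, by linarith [a2.2]⟩).1 h1
    have h3 : (m : ℝ) = m' := by linarith
    exact_mod_cast h3
  have sub : ∃ w : ℕ → Plane, interPoints (fun i => Set.range (polar (F i))) ⊆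
      Set.image w (Finset.range E.length : Set ℕ) := by
    refine ⟨fun m => if hm : m < E.length then
      polar (F (E[m].out.1)) (((m : ℝ) + 1 / 2 : ℝ) : AddCircle T) else 0, ?_⟩
    rintro p ⟨i, j, hij, hi, hj⟩
    obtain ⟨m, hm, he, hp⟩ := key i j hij p hi hj
    refine ⟨m, by simpa using hm, ?_⟩
    dsimp only
    rw [dif_pos hm, hp]
    have he' : E[m] = s(i, j) := (List.getElem?_eq_some_iff.1 he).2
    have ho : E[m].out.1 ∈ s(i, j) := by
      rw [← he']; exact Sym2.out_fst_mem _
    rcases Sym2.mem_iff.1 ho with h | h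
    · rw [h]
    · rw [h]; exact (key2 m i j hij he).symm
  obtain ⟨w, hw⟩ := sub
  have fin := (Finset.finite_toSet (Finset.range E.length)).image w
  refine ⟨fun i => Set.range (polar (F i)), ?_, fun i => polar_jordan _ (hFc i), ⟨?_, ?_⟩,
    fin.subset hw, ?_, ?_⟩
  · intro i k h
    by_contra hik
    have h : Set.range (polar (F i)) = Set.range (polar (F k)) := h
    have hm : polar (F i) ((0 : ℝ) : AddCircle T) ∈ Set.range (polar (F k)) := by
      rw [← h]; exact ⟨_, rfl⟩
    obtain ⟨θ, h1⟩ := hm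
    obtain ⟨rfl, h2⟩ := polar_eq hT.ne' _ _ _ _ h1
    rw [hF _ _ ⟨le_rfl, hT⟩, hF _ _ ⟨le_rfl, hT⟩] at h2
    obtain ⟨m, hm, -⟩ := (f4 0 le_rfl hT.le i k hik).1 h2.symm
    have : (0 : ℝ) ≤ m := by positivity
    linarith
  · intro i j hij
    exact (fin.subset hw).subset fun p hp => ⟨i, j, hij, hp.1, hp.2⟩
  · intro p i j k hi hj hk
    by_contra hcon
    push Not at hcon
    obtain ⟨hij, hik, hjk⟩ := hcon
    obtain ⟨m, hm, he, hp⟩ := key i j hij p hi hj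
    obtain ⟨m', hm', he', hp'⟩ := key i k hik p hi hk
    obtain rfl := meq m m' hm hm' i i (hp.symm.trans hp')
    rw [he] at he'
    have := Option.some_injective _ he'
    rw [Sym2.eq_iff] at this
    grind
  · calc _ ≤ _ := Set.ncard_le_ncard hw fin
      _ ≤ (Finset.range E.length : Set ℕ).ncard := Set.ncard_image_le (Finset.finite_toSet _)
      _ = _ := by rw [Set.ncard_coe_finset, Finset.card_range]
  · intro i k hik h1
    have hmem : s(i, k) ∈ E := List.count_pos_iff.1 (by omega)
    obtain ⟨m, hm, he⟩ := List.getElem_of_mem hmem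
    have he' : E[m]? = some s(i, k) := List.getElem?_eq_some_iff.2 ⟨hm, he⟩
    refine ⟨polar (F i) (((m : ℝ) + 1 / 2 : ℝ) : AddCircle T), ?_⟩
    ext p
    constructor
    · rintro ⟨hi, hk⟩
      obtain ⟨m', hm', he2, hp⟩ := key i k hik p hi hk
      have : m' = m := by
        by_contra hne
        have : List.Duplicate s(i, k) E := by
          rw [List.duplicate_iff_exists_distinct_get]
          rcases lt_or_gt_of_ne hne with h | h
          · exact ⟨⟨m', hm'⟩, ⟨m, hm⟩, h, by
              simpa using (List.getElem?_eq_some_iff.1 he2).2.symm, by simpa using he.symm⟩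
          · exact ⟨⟨m, hm⟩, ⟨m', hm'⟩, h, by simpa using he.symm, by
              simpa using (List.getElem?_eq_some_iff.1 he2).2.symm⟩
        have := List.duplicate_iff_two_le_count.1 this
        omega
      rw [hp, this]; rfl
    · rintro rfl
      exact ⟨⟨_, rfl⟩, ⟨_, (key2 m i k hik he').symm⟩⟩

/-- Lower-bound construction (Fox–Frankl–Pach–Pálvölgyi): for all large `n` there is a
family of `n` closed Jordan curves in general position with `Ω(n²)` touching pairs but
only `O(n² log n)` intersection points. -/
theorem many_touchings_few_intersections :
    ∃ c C : ℝ, 0 < c ∧ 0 < C ∧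
      ∃ n₀ : ℕ, ∀ n : ℕ, n₀ ≤ n →
        ∃ γ : Fin n → Set Plane,
          Function.Injective γ ∧
          (∀ i, IsJordanCurve (γ i)) ∧
          GenPos γ ∧
          (interPoints γ).Finite ∧
          c * (n : ℝ) ^ 2 ≤ (touchingPairs γ : ℝ) ∧
          ((interPoints γ).ncard : ℝ) ≤ C * (n : ℝ) ^ 2 * Real.log n := by
  have hl2 : 0 < Real.log 2 := Real.log_pos (by norm_num)
  refine ⟨1 / 16, 1 / (2 * Real.log 2), by norm_num, by positivity, 2, ?_⟩
  intro n hn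
  obtain ⟨k, hk⟩ : ∃ k, Nat.log 2 n = k + 1 :=
    ⟨Nat.log 2 n - 1, by have := Nat.log_pos (b := 2) (by norm_num) hn; omega⟩
  have hlo : 2 ^ (k + 1) ≤ n := hk ▸ Nat.pow_log_le_self 2 (by omega)
  have hhi : n < 2 ^ (k + 2) := by
    have := Nat.lt_pow_succ_log_self (b := 2) (by norm_num) n
    rwa [hk] at this
  set q := 2 ^ k with hq
  have e1 : 2 ^ (k + 1) = 2 * q := by rw [hq]; ring
  have e2 : 2 ^ (k + 2) = 4 * q := by rw [hq]; ring
  have e3 : 4 ^ k = q * q := by rw [hq, ← mul_pow]; norm_num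
  rw [e1] at hlo
  rw [e2] at hhi
  let L : List (Fin n) := List.finRange n
  obtain ⟨G, F, D, hL, hG, hF, hGm, hFm⟩ : ∃ G F D : List (Fin n), L = G ++ F ++ D ∧
      G.length = q ∧ F.length = q ∧ (∀ i : Fin n, i.1 < q → i ∈ G) ∧
      (∀ i : Fin n, q ≤ i.1 → i.1 < 2 * q → i ∈ F) := by
    refine ⟨L.take q, (L.drop q).take q, (L.drop q).drop q, by simp, ?_, ?_, ?_, ?_⟩
    · simp [L]; omega
    · simp [L]; omega
    · intro i hi
      rw [List.mem_take_iff_getElem]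
      exact ⟨i.1, by simp [L]; omega, by simp [L]⟩
    · intro i hi hi2
      rw [List.mem_take_iff_getElem]
      exact ⟨i.1 - q, by simp [L]; omega, by simp [L]; ext; simp; omega⟩
  have hnd : (G ++ F ++ D).Nodup := hL ▸ List.nodup_finRange n
  obtain ⟨E, hE, hEl, hEc, -⟩ := Pth.main k G F hG hF (hnd.sublist (List.sublist_append_left _ _))
  have hE' := hE.ctx [] D
  rw [List.nil_append] at hE'
  obtain ⟨γ, g1, g2, g3, g4, g5, g6⟩ := hE'.family hnd
    (fun i => hL ▸ List.mem_finRange i) (by rw [hEl]; positivity)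
  refine ⟨γ, g1, g2, g3, g4, ?_, ?_⟩
  · have hcard : q * q ≤ touchingPairs γ := by
      have hinj : Function.Injective (fun p : Fin q × Fin q =>
          ((⟨p.1.1, by have := p.1.2; omega⟩, ⟨p.2.1 + q, by have := p.2.2; omega⟩) :
            Fin n × Fin n)) := by
        rintro ⟨a, b⟩ ⟨a', b'⟩ h
        simp only [Prod.mk.injEq, Fin.mk.injEq] at h
        ext
        · exact h.1
        · have := h.2; simp; omega
      have : (Set.range (fun p : Fin q × Fin q =>
          ((⟨p.1.1, by have := p.1.2; omega⟩, ⟨p.2.1 + q, by have := p.2.2; omega⟩) :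
            Fin n × Fin n))).ncard = q * q := by
        rw [← Set.image_univ, Set.ncard_image_of_injective _ hinj, Set.ncard_univ]
        simp
      rw [← this]
      refine Set.ncard_le_ncard ?_ (Set.toFinite _)
      rintro _ ⟨⟨a, b⟩, rfl⟩
      have ha := a.2
      have hb := b.2
      refine ⟨?_, ?_⟩
      · rw [Fin.lt_def]; simp; omega
      · refine g6 _ _ ?_ (hEc _ (hGm _ ha) _ (hFm _ ?_ ?_))
        · intro h; rw [Fin.ext_iff] at h; simp at h; omega
        · simp
        · simp; omega
    have h1 : ((q * q : ℕ) : ℝ) ≤ touchingPairs γ := Nat.cast_le.2 hcard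
    have h2 : (n : ℝ) ≤ 4 * q := by exact_mod_cast hhi.le
    have h3 : (0 : ℝ) ≤ n := by positivity
    push_cast at h1
    nlinarith
  · have h1 : ((interPoints γ).ncard : ℝ) ≤ (k + 1) * (q * q) := by
      rw [hEl, e3] at g5
      exact_mod_cast g5
    have h2 : (2 : ℝ) * q ≤ n := by exact_mod_cast hlo
    have hl2 : 0 < Real.log 2 := Real.log_pos (by norm_num)
    have h3 : (k + 1) * Real.log 2 ≤ Real.log n := by
      have h := Real.log_le_log (by positivity) h2
      have : (2 : ℝ) * q = 2 ^ (k + 1) := by exact_mod_cast e1.symm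
      rw [this, Real.log_pow] at h
      exact_mod_cast h
    have hq0 : (0 : ℝ) ≤ q := by positivity
    have h4 : (q : ℝ) * q ≤ n ^ 2 / 2 := by nlinarith
    have h5 : (k : ℝ) + 1 ≤ Real.log n / Real.log 2 := (le_div_iff₀ hl2).2 h3
    calc _ ≤ _ := h1
      _ ≤ (Real.log n / Real.log 2) * (n ^ 2 / 2) := by gcongr
      _ = _ := by field_simp
end
end
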